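/- arXiv:1401.2294 — 5 statements merged into one kernel-verified Lean document; each statement's English description precedes it below -/
import Mathlib

section
/- Let d ≥ 1, let X ⊆ S^{ℤ^d} be a subshift of finite type and let Y ⊆ S^{ℤ^d} be any subshift. Then the universal extension A(X,Y) is a subshift of finite type. -/
namespace QE

/-- A finite pattern over the alphabet `S` on the group of positions `V`:
a finite domain `D ⊆ V` together with an assignment of symbols to `D`. -/
def Pattern (V S : Type*) : Type _ :=
  Σ D : Finset V, {v : V // v ∈ D} → S

variable {V S T : Type*}

/-- The pattern `P` occurs in the configuration `x` (at some translate). -/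
def occursIn [Add V] (P : Pattern V S) (x : V → S) : Prop :=
  ∃ t : V, ∀ w : {v : V // v ∈ P.1}, x (t + w.1) = P.2 w

/-- The subshift defined by the set `F` of forbidden patterns. -/
def shiftOf [Add V] (F : Set (Pattern V S)) : Set (V → S) :=
  {x | ∀ P ∈ F, ¬ occursIn P x}

/-- `X` is a subshift: it is defined by some set of forbidden patterns. -/
def IsSubshift [Add V] (X : Set (V → S)) : Prop :=
  ∃ F : Set (Pattern V S), X = shiftOf F

/-- `X` is a subshift of finite type: defined by a finite set of forbidden patterns. -/
def IsSFT [Add V] (X : Set (V → S)) : Prop :=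
  ∃ F : Set (Pattern V S), F.Finite ∧ X = shiftOf F

/-- The language of `X`: all finite patterns occurring in some configuration of `X`. -/
def lang [Add V] (X : Set (V → S)) : Set (Pattern V S) :=
  {P | ∃ x ∈ X, occursIn P x}

/-- `φ` acts on `Z` as a block map: it is given by a local function on a finite neighborhood. -/
def IsBlockMapOn [Add V] (Z : Set (V → S)) (φ : (V → S) → V → T) : Prop :=
  ∃ (D : Finset V) (Φ : ({v : V // v ∈ D} → S) → T),
    ∀ x ∈ Z, ∀ t : V, φ x t = Φ fun w => x (t + w.1)

/-- `X` is a sofic shift: the image of an SFT (over some finite alphabet) under a block map. -/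
def IsSofic [Add V] (X : Set (V → S)) : Prop :=
  ∃ (T' : Type) (_ : Fintype T') (Z : Set (V → T')) (φ : (V → T') → V → S),
    IsSFT Z ∧ IsBlockMapOn Z φ ∧ φ '' Z = X

/-- `X` is a countably covered sofic shift: the image of a countable SFT under a block map. -/
def IsCountablyCovered [Add V] (X : Set (V → S)) : Prop :=
  ∃ (T' : Type) (_ : Fintype T') (Z : Set (V → T')) (φ : (V → T') → V → S),
    IsSFT Z ∧ Z.Countable ∧ IsBlockMapOn Z φ ∧ φ '' Z = X

/-- Fill the holes (`none`-symbols) of the pattern `P` using the pattern `Q`: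
this is `P^{(Q)}`. -/
def fill (P : Pattern V (Option S)) (Q : {v : V // v ∈ P.1} → S) : Pattern V S :=
  ⟨P.1, fun w => (P.2 w).getD (Q w)⟩

/-- The universal extension `A(X,Y)`, a subshift over the alphabet `Option S`
(`none` playing the role of the hole symbol `□`). -/
def univExt [Add V] (X Y : Set (V → S)) : Set (V → Option S) :=
  shiftOf {P : Pattern V (Option S) |
    ∃ Q : {v : V // v ∈ P.1} → S, (⟨P.1, Q⟩ : Pattern V S) ∈ lang Y ∧ fill P Q ∉ lang X}

/-- The existential extension `E(X,Y)`, a subshift over the alphabet `Option S`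
(`none` playing the role of the hole symbol `□`). -/
def existExt [Add V] (X Y : Set (V → S)) : Set (V → Option S) :=
  shiftOf {P : Pattern V (Option S) |
    ∀ Q : {v : V // v ∈ P.1} → S, (⟨P.1, Q⟩ : Pattern V S) ∈ lang Y → fill P Q ∉ lang X}


/-- Subshifts are invariant under translation. -/
lemma translate_mem_shiftOf [AddSemigroup V] {F : Set (Pattern V S)} {x : V → S}
    (hx : x ∈ shiftOf F) (s : V) : (fun v => x (s + v)) ∈ shiftOf F := by
  rintro P hP ⟨t, ht⟩
  exact hx P hP ⟨s + t, fun w => by rw [add_assoc]; exact ht w⟩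

/-- The holes of a configuration can be filled symbolwise by a configuration, compatibly with
the filling of patterns. -/
lemma occursIn_fill_of_eq [Add V] {P : Pattern V (Option S)} {Q : {v : V // v ∈ P.1} → S}
    {z : V → Option S} {y : V → S} {t : V} (hz : ∀ w : {v : V // v ∈ P.1}, z (t + w.1) = P.2 w)
    (hy : ∀ w : {v : V // v ∈ P.1}, y (t + w.1) = Q w) :
    occursIn (fill P Q) fun v => (z v).getD (y v) :=
  ⟨t, fun w => by simp only [fill]; rw [hz w, hy w]⟩

/-- Finitely many patterns with holes can be filled to a pattern in a given finite set. -/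
lemma finite_setOf_fill_mem [Finite S] {F : Set (Pattern V S)} (hF : F.Finite)
    (L : Set (Pattern V S)) :
    {P : Pattern V (Option S) | ∃ Q : {v : V // v ∈ P.1} → S,
      (⟨P.1, Q⟩ : Pattern V S) ∈ L ∧ fill P Q ∈ F}.Finite := by
  refine (hF.biUnion fun R _ => Set.finite_range
    fun p : {v : V // v ∈ R.1} → Option S => (⟨R.1, p⟩ : Pattern V (Option S))).subset ?_
  rintro P ⟨Q, -, hPQ⟩
  exact Set.mem_biUnion hPQ ⟨P.2, rfl⟩

/-- The universal extension is defined by those patterns that can be filled, by a pattern of `Y`,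
to one of the forbidden patterns defining `X`. -/
lemma univExt_shiftOf [AddGroup V] (F : Set (Pattern V S)) {Y : Set (V → S)} (hY : IsSubshift Y) :
    univExt (shiftOf F) Y = shiftOf {P : Pattern V (Option S) | ∃ Q : {v : V // v ∈ P.1} → S,
      (⟨P.1, Q⟩ : Pattern V S) ∈ lang Y ∧ fill P Q ∈ F} := by
  obtain ⟨G, rfl⟩ := hY
  apply Set.Subset.antisymm
  · rintro z hz P ⟨Q, hQ, hPQ⟩
    exact hz P ⟨Q, hQ, fun ⟨x, hx, hocc⟩ => hx _ hPQ hocc⟩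
  · rintro z hz P ⟨Q, ⟨y, hy, s, hs⟩, hPQ⟩ ⟨t, ht⟩
    have hy' := translate_mem_shiftOf hy (s + -t)
    refine hPQ ⟨_, ?_, occursIn_fill_of_eq (y := fun v => y (s + -t + v)) ht fun w => ?_⟩
    · rintro R hR ⟨r, hr⟩
      refine hz ⟨R.1, fun w => z (r + w.1)⟩ ⟨fun w => y (s + -t + (r + w.1)),
        ⟨_, hy', r, fun w => rfl⟩, ?_⟩ ⟨r, fun w => rfl⟩
      rwa [show fill (⟨R.1, fun w => z (r + w.1)⟩ : Pattern V (Option S))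
        (fun w => y (s + -t + (r + w.1))) = R from Sigma.ext rfl (heq_of_eq (funext hr))]
    · simpa [add_assoc] using hs w

/-- If `d ≥ 1`, `X ⊆ S^{ℤ^d}` is an SFT and `Y ⊆ S^{ℤ^d}` is any subshift,
then the universal extension `A(X,Y)` is an SFT. -/
theorem stmt0 (d : ℕ) (hd : 1 ≤ d) (S : Type) [Fintype S]
    (X Y : Set ((Fin d → ℤ) → S)) (hX : IsSFT X) (hY : IsSubshift Y) :
    IsSFT (univExt X Y) := by
  obtain ⟨F, hF, rfl⟩ := hX
  exact ⟨_, finite_setOf_fill_mem hF (lang Y), univExt_shiftOf F hY⟩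

end QE
end

section
/- Let S = {0,1}, let X ⊆ S^ℤ be the one-dimensional SFT defined by the single forbidden word 0100, and let Y = S^ℤ be the full shift. Then the existential extension E(X,Y) is not a subshift of finite type; in particular, the configurations x = …0001(0□)(0□)(0□)… and x' = …(0□)(0□)0000… belong to E(X,Y), but for every n ≥ 1 the configuration …0001(0□)^n 0000… does not. -/
namespace QE

variable {V S T : Type*}

/-- The single forbidden word `0100` of the SFT `X`, as a pattern on the domain `{0,1,2,3} ⊆ ℤ`. -/
def word0100 : Pattern ℤ (Fin 2) :=
  ⟨{0, 1, 2, 3}, fun w => if w.1 = 1 then 1 else 0⟩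

/-- The one-dimensional SFT over `{0,1}` defined by the single forbidden word `0100`. -/
def Xex : Set (ℤ → Fin 2) := shiftOf {word0100}

/-- The full shift `Y = {0,1}^ℤ`. -/
def Yex : Set (ℤ → Fin 2) := Set.univ

/-- The configuration `x = …0001(0□)(0□)(0□)…` (the symbol `1` at position `0`). -/
def xConf : ℤ → Option (Fin 2) := fun i =>
  if i < 0 then some 0 else if i = 0 then some 1
  else if i % 2 = 1 then some 0 else none

/-- The configuration `x' = …(0□)(0□)0000…` (the block of `0`'s starting at position `0`). -/
def x'Conf : ℤ → Option (Fin 2) := fun i =>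
  if 0 ≤ i then some 0 else if i % 2 = 0 then some 0 else none

/-- The configuration `…0001(0□)^n 0000…` (the symbol `1` at position `0`,
followed by `n` blocks `0□` on positions `1,…,2n`, then only `0`'s). -/
def zConf (n : ℕ) : ℤ → Option (Fin 2) := fun i =>
  if i < 0 then some 0 else if i = 0 then some 1
  else if 2 * (n : ℤ) < i then some 0
  else if i % 2 = 1 then some 0 else none

theorem mem_Xex_iff {y : ℤ → Fin 2} :
    y ∈ Xex ↔ ∀ t, y t = 0 → y (t + 1) = 1 → y (t + 2) = 0 → y (t + 3) ≠ 0 := by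
  have h : y ∈ Xex ↔ ¬ occursIn word0100 y :=
    ⟨fun hy => hy _ rfl, fun hy P hP => (Set.mem_singleton_iff.1 hP) ▸ hy⟩
  rw [h]
  simp only [occursIn, not_exists]
  refine forall_congr' fun t => ⟨fun ht h₀ h₁ h₂ h₃ => ht ?_, fun ht hw => ?_⟩
  · rintro ⟨w, hw⟩
    simp only [word0100, Finset.mem_insert, Finset.mem_singleton] at hw
    rcases hw with rfl | rfl | rfl | rfl <;> simpa [word0100]
  · refine ht ?_ ?_ ?_ ?_
    · simpa [word0100] using hw ⟨0, by simp [word0100]⟩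
    · exact hw ⟨1, by simp [word0100]⟩
    · exact hw ⟨2, by simp [word0100]⟩
    · exact hw ⟨3, by simp [word0100]⟩

/-- A configuration with a completion of its holes in `X` lies in `E(X,Y)`, `Y` the full shift. -/
theorem mem_existExt_of_completion {X : Set (ℤ → Fin 2)} {x : ℤ → Option (Fin 2)} {y : ℤ → Fin 2}
    (hy : y ∈ X) (hxy : ∀ i, (x i).getD (y i) = y i) : x ∈ existExt X Yex := by
  rintro P hP ⟨t, ht⟩
  refine hP (fun w => y (t + w.1)) ⟨fun v => y (t + v), Set.mem_univ _, 0, fun w => ?_⟩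
    ⟨y, hy, t, fun w => ?_⟩
  · simp
  · simp [fill, ← ht w, hxy]

/-- Up to translation, a point of `E(X,Y)` has completions in `X` on every finite domain. -/
theorem exists_completion_of_mem_existExt {X Y : Set (ℤ → Fin 2)} {x : ℤ → Option (Fin 2)}
    (hx : x ∈ existExt X Y) (D : Finset ℤ) :
    ∃ y ∈ X, ∃ t, ∀ i ∈ D, ∀ a, x i = some a → y (t + i) = a := by
  by_contra! h
  refine hx ⟨D, fun w => x w.1⟩ ?_ ⟨0, fun w => by simp⟩
  rintro Q - ⟨y, hy, t, ht⟩
  obtain ⟨i, hi, a, hxa, hne⟩ := h y hy t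
  exact hne (by simpa [fill, hxa] using ht ⟨i, hi⟩)

theorem xConf_mem : xConf ∈ existExt Xex Yex := by
  refine mem_existExt_of_completion (y := fun i => if i < 0 then 0 else if i % 2 = 1 then 0 else 1)
    (mem_Xex_iff.2 fun t => ?_) fun i => ?_
  · grind
  · simp only [xConf]
    grind

theorem x'Conf_mem : x'Conf ∈ existExt Xex Yex := by
  refine mem_existExt_of_completion (y := fun _ => 0) (mem_Xex_iff.2 fun t => ?_) fun i => ?_
  · simp
  · simp only [x'Conf]
    grind

theorem zConf_notMem (n : ℕ) : zConf n ∉ existExt Xex Yex := by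
  intro hz
  obtain ⟨y, hy, t, ht⟩ := exists_completion_of_mem_existExt hz (Finset.Icc (-1) (2 * n + 2))
  rw [mem_Xex_iff] at hy
  have zero_at : ∀ i : ℤ, -1 ≤ i → i ≤ 2 * n + 2 → i < 0 ∨ i % 2 = 1 ∨ 2 * n < i →
      y (t + i) = 0 := by
    intro i h₁ h₂ h₃
    refine ht i (Finset.mem_Icc.2 ⟨h₁, h₂⟩) 0 ?_
    simp only [zConf]
    grind
  have one_at : ∀ k : ℕ, k ≤ n → y (t + 2 * k) = 1 := by
    intro k
    induction k with
    | zero =>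
      intro _
      exact ht 0 (Finset.mem_Icc.2 ⟨by lia, by lia⟩) 1 (by simp [zConf])
    | succ k ih =>
      intro hk
      have h₀ := zero_at (2 * k - 1) (by lia) (by lia) (by lia)
      have h₂ := zero_at (2 * k + 1) (by lia) (by lia) (by lia)
      have h₃ := hy (t + (2 * k - 1)) h₀ (by convert ih (by lia) using 2; ring)
        (by convert h₂ using 2; ring)
      rw [show t + (2 * (k : ℤ) - 1) + 3 = t + 2 * (k + 1 : ℕ) by push_cast; ring] at h₃
      exact Fin.eq_one_of_ne_zero _ h₃
  have h₀ := zero_at (2 * n - 1) (by lia) (by lia) (by lia)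
  have h₂ := zero_at (2 * n + 1) (by lia) (by lia) (by lia)
  have h₃ := zero_at (2 * n + 2) (by lia) (by lia) (by lia)
  refine hy (t + (2 * n - 1)) h₀ ?_ ?_ ?_
  · convert one_at n le_rfl using 2; ring
  · convert h₂ using 2; ring
  · convert h₃ using 2; ring

theorem zConf_eq_xConf {n : ℕ} {i : ℤ} (hi : i ≤ 2 * n) : zConf n i = xConf i := by
  simp only [zConf, xConf]
  grind

theorem zConf_eq_x'Conf {n : ℕ} {i : ℤ} (hi : 1 ≤ i) : zConf n i = x'Conf (i - (2 * n + 1)) := by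
  simp only [zConf, x'Conf]
  grind

/-- Finitely many patterns over `ℤ` have their domains in a common interval. -/
theorem exists_bound_of_finite {S : Type*} {F : Set (Pattern ℤ S)} (hF : F.Finite) :
    ∃ N : ℕ, ∀ P ∈ F, ∀ w ∈ P.1, |w| ≤ N := by
  classical
  refine ⟨(hF.toFinset.biUnion fun P => P.1).sup Int.natAbs, fun P hP w hw => ?_⟩
  have h : w ∈ hF.toFinset.biUnion fun P => P.1 :=
    Finset.mem_biUnion.2 ⟨P, hF.mem_toFinset.2 hP, hw⟩
  rw [Int.abs_eq_natAbs]
  exact_mod_cast Finset.le_sup (f := Int.natAbs) h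

theorem not_isSFT_existExt : ¬ IsSFT (existExt Xex Yex) := by
  rintro ⟨F, hF, hE⟩
  obtain ⟨N, hN⟩ := exists_bound_of_finite hF
  have hx := xConf_mem
  have hx' := x'Conf_mem
  have hz := zConf_notMem (N + 1)
  rw [hE] at hx hx' hz
  refine hz ?_
  rintro P hP ⟨t, ht⟩
  by_cases htN : t + N ≤ 2 * (N + 1 : ℕ)
  · refine hx P hP ⟨t, fun w => ?_⟩
    have hw := abs_le.1 (hN P hP w.1 w.2)
    rw [← ht w, zConf_eq_xConf (by lia)]
  · refine hx' P hP ⟨t - (2 * (N + 1 : ℕ) + 1), fun w => ?_⟩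
    have hw := abs_le.1 (hN P hP w.1 w.2)
    rw [← ht w, zConf_eq_x'Conf (by lia)]
    congr 1
    ring

/-- For `S = {0,1}`, `X` the SFT with forbidden word `0100`
and `Y` the full shift, the existential extension `E(X,Y)` is not an SFT; in particular
`x = …0001(0□)(0□)(0□)…` and `x' = …(0□)(0□)0000…` belong to `E(X,Y)`,
but `…0001(0□)^n 0000… ∉ E(X,Y)` for all `n ≥ 1`. -/
theorem stmt1 :
    ¬ IsSFT (existExt Xex Yex) ∧
    xConf ∈ existExt Xex Yex ∧
    x'Conf ∈ existExt Xex Yex ∧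
    ∀ n : ℕ, 1 ≤ n → zConf n ∉ existExt Xex Yex := by
  exact ⟨not_isSFT_existExt, xConf_mem, x'Conf_mem, fun n _ => zConf_notMem n⟩

end QE
end

section
/- Let d ≥ 1 and let X, Y ⊆ S^{ℤ^d} be sofic shifts. Then the existential extension E(X,Y) is a sofic shift. -/
namespace QE

variable {V S T : Type*}

theorem IsSFT.inter {V S : Type*} [Add V] {X Y : Set (V → S)} (hX : IsSFT X) (hY : IsSFT Y) :
    IsSFT (X ∩ Y) := by
  obtain ⟨F, hF, rfl⟩ := hX
  obtain ⟨G, hG, rfl⟩ := hY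
  refine ⟨F ∪ G, hF.union hG, ?_⟩
  ext x
  simp only [shiftOf, Set.mem_inter_iff, Set.mem_ofPred_eq, Set.mem_union]
  exact ⟨fun h P hP => hP.elim (h.1 P) (h.2 P),
    fun h => ⟨fun P hP => h P (.inl hP), fun P hP => h P (.inr hP)⟩⟩

/-- The preimage of an SFT under a letter-to-letter map is an SFT. -/
theorem IsSFT.preimage_letterMap {V S T : Type*} [Add V] [Finite T] {X : Set (V → S)}
    (hX : IsSFT X) (f : T → S) : IsSFT {z : V → T | (fun v => f (z v)) ∈ X} := by
  obtain ⟨F, hF, rfl⟩ := hX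
  refine ⟨⋃ P ∈ F, (fun q : {v : V // v ∈ P.1} → T => (⟨P.1, q⟩ : Pattern V T)) ''
    {q | ∀ w, f (q w) = P.2 w}, hF.biUnion fun P _ => (Set.toFinite _).image _, ?_⟩
  ext z
  simp only [shiftOf, Set.mem_ofPred_eq, Set.mem_iUnion]
  constructor
  · rintro h _ ⟨P, hP, q, hq, rfl⟩ ⟨t, ht⟩
    exact h P hP ⟨t, fun w => (congrArg f (ht w)).trans (hq w)⟩
  · rintro h P hP ⟨t, ht⟩
    exact h _ ⟨P, hP, fun w => z (t + w.1), ht, rfl⟩ ⟨t, fun _ => rfl⟩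

/-- A condition checked through a finite window at every position defines an SFT. -/
theorem isSFT_setOf_forall_window {V T : Type*} [Add V] [Finite T] (D : Finset V)
    (p : ({v : V // v ∈ D} → T) → Prop) :
    IsSFT {z : V → T | ∀ t, p fun w => z (t + w.1)} := by
  refine ⟨(fun q => (⟨D, q⟩ : Pattern V T)) '' {q | ¬ p q}, (Set.toFinite _).image _, ?_⟩
  ext z
  constructor
  · rintro h _ ⟨q, hq, rfl⟩ ⟨t, ht⟩
    exact hq ((funext ht : (fun w : {v : V // v ∈ D} => z (t + w.1)) = q) ▸ h t)
  · intro h t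
    by_contra hp
    exact h _ ⟨_, hp, rfl⟩ ⟨t, fun _ => rfl⟩

theorem shiftOf_translate {V S : Type*} [AddSemigroup V] {F : Set (Pattern V S)} {x : V → S}
    (hx : x ∈ shiftOf F) (s : V) : (fun v => x (s + v)) ∈ shiftOf F := by
  rintro P hP ⟨t, ht⟩
  exact hx P hP ⟨s + t, fun w => by rw [add_assoc]; exact ht w⟩

theorem IsSofic.translate {V S : Type*} [AddSemigroup V] {X : Set (V → S)} (hX : IsSofic X)
    {x : V → S} (hx : x ∈ X) (s : V) : (fun v => x (s + v)) ∈ X := by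
  obtain ⟨T, _, Z, φ, ⟨F, -, rfl⟩, ⟨D, Φ, hΦ⟩, rfl⟩ := hX
  obtain ⟨z, hz, rfl⟩ := hx
  refine ⟨_, shiftOf_translate hz s, ?_⟩
  funext t
  rw [hΦ _ (shiftOf_translate hz s), hΦ z hz]
  simp only [add_assoc]

theorem isClosed_shiftOf {V S : Type*} [Add V] [TopologicalSpace S] [DiscreteTopology S]
    (F : Set (Pattern V S)) : IsClosed (shiftOf F) := by
  have h : shiftOf F = ⋂ P ∈ F, ⋂ t : V, (⋂ w : {v : V // v ∈ P.1},
      (fun x : V → S => x (t + w.1)) ⁻¹' {P.2 w})ᶜ := by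
    ext x
    simp [shiftOf, occursIn]
  rw [h]
  refine isClosed_biInter fun P _ => isClosed_iInter fun t => IsOpen.isClosed_compl ?_
  exact isOpen_iInter_of_finite fun w => (isOpen_discrete _).preimage (continuous_apply _)

theorem IsSofic.isClosed {V S : Type*} [Add V] [TopologicalSpace S] [DiscreteTopology S]
    {X : Set (V → S)} (hX : IsSofic X) : IsClosed X := by
  obtain ⟨T, _, Z, φ, ⟨F, -, rfl⟩, ⟨D, Φ, hΦ⟩, rfl⟩ := hX
  let _ : TopologicalSpace T := ⊥
  have : DiscreteTopology T := ⟨rfl⟩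
  refine ((isClosed_shiftOf F).isCompact.image_of_continuousOn ?_).isClosed
  have hc : Continuous fun (z : V → T) (t : V) => Φ fun w => z (t + w.1) :=
    continuous_pi fun t => continuous_of_discreteTopology.comp
      (continuous_pi fun w => continuous_apply _)
  exact hc.continuousOn.congr fun z hz => funext (hΦ z hz)

theorem IsSofic.mem_of_forall_finset {V S : Type*} [Add V] {X : Set (V → S)} (hX : IsSofic X)
    {x : V → S} (h : ∀ D : Finset V, ∃ x' ∈ X, ∀ v ∈ D, x' v = x v) : x ∈ X := by
  let _ : TopologicalSpace S := ⊥
  have : DiscreteTopology S := ⟨rfl⟩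
  rw [← hX.isClosed.closure_eq, mem_closure_iff]
  intro U hU hxU
  obtain ⟨D, u, hu, hDU⟩ := isOpen_pi_iff.1 hU x hxU
  obtain ⟨x', hx', heq⟩ := h D
  refine ⟨x', hDU fun v hv => ?_, hx'⟩
  rw [heq v hv]
  exact (hu v hv).2

/-- The configurations whose holes can be filled by a configuration of `Y` so as to give
a configuration of `X` form a sofic shift. -/
theorem isSofic_setOf_exists_getD_mem {V : Type*} [AddMonoid V] {S : Type} [Finite S]
    {X Y : Set (V → S)} (hX : IsSofic X) (hY : IsSofic Y) :
    IsSofic {x : V → Option S | ∃ y ∈ Y, (fun v => (x v).getD (y v)) ∈ X} := by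
  classical
  have := Fintype.ofFinite S
  obtain ⟨T₁, _, Z₁, φ₁, hZ₁, ⟨D₁, Φ₁, hΦ₁⟩, rfl⟩ := hX
  obtain ⟨T₂, _, Z₂, φ₂, hZ₂, ⟨D₂, Φ₂, hΦ₂⟩, rfl⟩ := hY
  let W : Set (V → T₁ × T₂ × Option S) := {z | ∀ t, Φ₁ (fun w => (z (t + w.1)).1) =
    (z t).2.2.getD (Φ₂ fun w => (z (t + w.1)).2.1)}
  have hW : IsSFT W := by
    have := isSFT_setOf_forall_window (T := T₁ × T₂ × Option S) (insert 0 (D₁ ∪ D₂))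
      fun q => Φ₁ (fun w => (q ⟨w.1, by simp [w.2]⟩).1) =
        (q ⟨0, by simp⟩).2.2.getD (Φ₂ fun w => (q ⟨w.1, by simp [w.2]⟩).2.1)
    simpa only [add_zero] using this
  refine ⟨T₁ × T₂ × Option S, inferInstance, _, fun z v => (z v).2.2,
    ((hZ₁.preimage_letterMap fun a : T₁ × T₂ × Option S => a.1).inter
      (hZ₂.preimage_letterMap fun a => a.2.1)).inter hW,
    ⟨{0}, fun q => (q ⟨0, by simp⟩).2.2, fun z _ t => by simp⟩, ?_⟩
  ext x
  constructor
  · rintro ⟨z, ⟨⟨h₁, h₂⟩, h⟩, rfl⟩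
    refine ⟨_, ⟨_, h₂, rfl⟩, _, h₁, funext fun t => ?_⟩
    rw [hΦ₁ _ h₁, hΦ₂ _ h₂]
    exact h t
  · rintro ⟨_, ⟨z₂, h₂, rfl⟩, z₁, h₁, h⟩
    refine ⟨fun v => (z₁ v, z₂ v, x v), ⟨⟨h₁, h₂⟩, fun t => ?_⟩, rfl⟩
    have := congrFun h t
    rwa [hΦ₁ _ h₁, hΦ₂ _ h₂] at this

/-- By compactness, a configuration lies in the existential extension of sofic shifts
exactly when its holes can be filled globally. -/
theorem existExt_eq_setOf_exists_getD_mem {V : Type*} [AddMonoid V] {S : Type} [Finite S]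
    {X Y : Set (V → S)} (hX : IsSofic X) (hY : IsSofic Y) :
    existExt X Y = {x : V → Option S | ∃ y ∈ Y, (fun v => (x v).getD (y v)) ∈ X} := by
  classical
  ext x
  constructor
  · refine fun hx => (isSofic_setOf_exists_getD_mem hX hY).mem_of_forall_finset fun D => ?_
    have hP := mt (hx (⟨D, fun w => x w.1⟩ : Pattern V (Option S)))
      (not_not.2 ⟨0, fun w => by simp⟩)
    obtain ⟨Q, hQ⟩ := not_forall.1 hP
    obtain ⟨⟨y, hy, s, hs⟩, hfill⟩ := Classical.not_imp.1 hQ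
    obtain ⟨x₁, hx₁, t, ht⟩ := not_not.1 hfill
    refine ⟨fun v => if v ∈ D then x v else some (x₁ (t + v)), ⟨_, hY.translate hy s, ?_⟩,
      fun v hv => if_pos hv⟩
    convert hX.translate hx₁ t using 2 with v
    beta_reduce
    split_ifs with hv
    · exact (congrArg (x v).getD (hs ⟨v, hv⟩)).trans (ht ⟨v, hv⟩).symm
    · rfl
  · rintro ⟨y, hy, hxy⟩ P hP ⟨t, ht⟩
    refine hP (fun w => y (t + w.1)) ⟨y, hy, t, fun _ => rfl⟩ ⟨_, hxy, t, fun w => ?_⟩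
    exact congrArg (Option.getD · _) (ht w)

/-- If `d ≥ 1` and `X, Y ⊆ S^{ℤ^d}` are sofic shifts, then the
existential extension `E(X,Y)` is a sofic shift. -/
theorem stmt2 (d : ℕ) (hd : 1 ≤ d) (S : Type) [Fintype S]
    (X Y : Set ((Fin d → ℤ) → S)) (hX : IsSofic X) (hY : IsSofic Y) :
    IsSofic (existExt X Y) := by
  rw [existExt_eq_setOf_exists_getD_mem hX hY]
  exact isSofic_setOf_exists_getD_mem hX hY

end QE
end

section
/- Let X, Y ⊆ S^ℤ be one-dimensional sofic shifts. Then the universal extension A(X,Y) is a sofic shift. -/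
namespace QE

variable {V S T : Type*}

/-- `q` is a bi-infinite path labelled by `x` in the labelled graph with edge relation `R`. -/
def IsRun {Q S : Type*} (R : Q → S → Q → Prop) (x : ℤ → S) (q : ℤ → Q) : Prop :=
  ∀ i, R (q i) (x i) (q (i + 1))

/-- The set of label sequences of bi-infinite paths in a labelled graph. -/
def graphShift {Q S : Type*} (R : Q → S → Q → Prop) : Set (ℤ → S) :=
  {x | ∃ q, IsRun R x q}

theorem IsRun.shift {Q S : Type*} {R : Q → S → Q → Prop} {x : ℤ → S} {q : ℤ → Q}
    (h : IsRun R x q) (t : ℤ) : IsRun R (fun i => x (i + t)) (fun i => q (i + t)) := by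
  intro i
  have := h (i + t)
  rwa [add_right_comm] at this

theorem shift_mem_graphShift {Q S : Type*} {R : Q → S → Q → Prop} {x : ℤ → S}
    (h : x ∈ graphShift R) (t : ℤ) : (fun i => x (i + t)) ∈ graphShift R := by
  obtain ⟨q, hq⟩ := h
  exact ⟨_, hq.shift t⟩

/-- Label sequences all of whose central blocks label finite paths label bi-infinite paths. -/
theorem mem_graphShift_of_forall_block {Q S : Type*} [Finite Q] {R : Q → S → Q → Prop}
    {x : ℤ → S}
    (h : ∀ n : ℕ, ∃ q : ℤ → Q, ∀ i : ℤ, -n ≤ i → i < n → R (q i) (x i) (q (i + 1))) :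
    x ∈ graphShift R := by
  choose q hq using h
  have hlim : ∀ i : ℤ, ∃ a, ∀ᶠ n in (Filter.hyperfilter ℕ : Filter ℕ), q n i = a := by
    intro i
    exact Ultrafilter.eventually_exists_iff.1 (Filter.Eventually.of_forall fun n => ⟨q n i, rfl⟩)
  choose a ha using hlim
  refine ⟨a, fun i => ?_⟩
  have hlarge : ∀ᶠ n in (Filter.hyperfilter ℕ : Filter ℕ), i.natAbs + 1 ≤ n :=
    Nat.hyperfilter_le_atTop (Filter.eventually_ge_atTop _)
  obtain ⟨n, h₁, h₂, h₃⟩ := ((ha i).and ((ha (i + 1)).and hlarge)).exists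
  rw [← h₁, ← h₂]
  exact hq n i (by omega) (by omega)

/-- The labels of a finite graph form a sofic shift. -/
theorem isSofic_graphShift {Q S : Type} [Finite Q] [Finite S] (R : Q → S → Q → Prop) :
    IsSofic (graphShift R) := by
  have := Fintype.ofFinite Q
  have := Fintype.ofFinite S
  let D : Finset ℤ := {0, 1}
  have h0 : (0 : ℤ) ∈ D := by simp [D]
  have h1 : (1 : ℤ) ∈ D := by simp [D]
  let bad : Set ({v : ℤ // v ∈ D} → Q × S) :=
    {P | ¬ R (P ⟨0, h0⟩).1 (P ⟨0, h0⟩).2 (P ⟨1, h1⟩).1}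
  let F : Set (Pattern ℤ (Q × S)) := Sigma.mk D '' bad
  have hF : ∀ x : ℤ → Q × S, x ∈ shiftOf F ↔ ∀ i, R (x i).1 (x i).2 (x (i + 1)).1 := by
    intro x
    constructor
    · intro hx i
      by_contra hR
      refine hx ⟨D, fun w => x (i + w.1)⟩ ⟨_, ?_, rfl⟩ ⟨i, fun w => rfl⟩
      simpa [bad] using hR
    · rintro hx _ ⟨P, hP, rfl⟩ ⟨t, ht⟩
      have e0 : x (t + 0) = P ⟨0, h0⟩ := ht ⟨0, h0⟩
      have e1 : x (t + 1) = P ⟨1, h1⟩ := ht ⟨1, h1⟩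
      apply hP
      rw [← e0, ← e1, add_zero]
      exact hx t
  refine ⟨Q × S, inferInstance, shiftOf F, fun x i => (x i).2,
    ⟨F, (Set.toFinite bad).image _, rfl⟩,
    ⟨{0}, fun u => (u ⟨0, by simp⟩).2, fun x _ t => by simp⟩, ?_⟩
  ext x
  constructor
  · rintro ⟨z, hz, rfl⟩
    exact ⟨fun i => (z i).1, (hF z).1 hz⟩
  · rintro ⟨q, hq⟩
    exact ⟨fun i => (q i, x i), (hF _).2 hq, rfl⟩

/-- Every one-dimensional sofic shift is presented by a finite labelled graph. -/
theorem IsSofic.exists_graphShift {S : Type} {X : Set (ℤ → S)} (hX : IsSofic X) :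
    ∃ (Q : Type) (_ : Finite Q) (R : Q → S → Q → Prop), X = graphShift R := by
  obtain ⟨T, _, Z, φ, ⟨F, hF, rfl⟩, ⟨D, Φ, hΦ⟩, rfl⟩ := hX
  obtain ⟨N, hND, hNF⟩ : ∃ N : ℕ, (∀ w ∈ D, w ∈ Finset.Icc (-N : ℤ) N) ∧
      ∀ P ∈ F, ∀ w ∈ P.1, w ∈ Finset.Icc (-N : ℤ) N := by
    let A : Finset ℤ := D ∪ hF.toFinset.biUnion Sigma.fst
    refine ⟨A.sup Int.natAbs, ?_⟩
    have key : ∀ w ∈ A, w ∈ Finset.Icc (-(A.sup Int.natAbs : ℕ) : ℤ) (A.sup Int.natAbs : ℕ) := by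
      intro w hw
      have : w.natAbs ≤ A.sup Int.natAbs := Finset.le_sup (f := Int.natAbs) hw
      rw [Finset.mem_Icc]
      omega
    refine ⟨fun w hw => key w (Finset.mem_union_left _ hw), fun P hP w hw => key w ?_⟩
    exact Finset.mem_union_right _ (Finset.mem_biUnion.2 ⟨P, hF.mem_toFinset.2 hP, hw⟩)
  let W := {v : ℤ // v ∈ Finset.Icc (-N : ℤ) N}
  let R : (W → T) → S → (W → T) → Prop := fun u s v =>
    (∀ j k : W, j.1 = k.1 + 1 → u j = v k) ∧
    (∀ P, ∀ hP : P ∈ F, ¬ ∀ w : {v : ℤ // v ∈ P.1}, u ⟨w.1, hNF P hP w.1 w.2⟩ = P.2 w) ∧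
    s = Φ fun w => u ⟨w.1, hND w.1 w.2⟩
  refine ⟨W → T, inferInstance, R, ?_⟩
  ext x
  constructor
  · rintro ⟨z, hz, rfl⟩
    refine ⟨fun i w => z (i + w.1), fun i => ⟨fun j k hjk => ?_, fun P hP hocc => ?_, hΦ z hz i⟩⟩
    · change z _ = z _
      congr 1
      omega
    · exact hz P hP ⟨i, hocc⟩
  · rintro ⟨q, hq⟩
    have h0 : (0 : ℤ) ∈ Finset.Icc (-N : ℤ) N := by simp
    have hwin : ∀ n : ℕ, ∀ (w : W) (i : ℤ), w.1.natAbs = n → q i w = q (i + w.1) ⟨0, h0⟩ := by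
      intro n
      induction n with
      | zero =>
        rintro ⟨w, hw⟩ i hn
        obtain rfl : w = 0 := by simpa using hn
        simp
      | succ n ih =>
        rintro ⟨w, hw⟩ i hn
        have hw' := Finset.mem_Icc.1 hw
        dsimp only at hn
        rcases lt_or_ge w 0 with hneg | hpos
        · have hk : w + 1 ∈ Finset.Icc (-N : ℤ) N := Finset.mem_Icc.2 (by omega)
          have h := (hq (i - 1)).1 ⟨w + 1, hk⟩ ⟨w, hw⟩ rfl
          rw [sub_add_cancel] at h
          rw [← h, ih ⟨w + 1, hk⟩ (i - 1) (by dsimp only; omega)]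
          congr 1
          dsimp only
          omega
        · have hk : w - 1 ∈ Finset.Icc (-N : ℤ) N := Finset.mem_Icc.2 (by omega)
          have h := (hq i).1 ⟨w, hw⟩ ⟨w - 1, hk⟩ (by dsimp only; omega)
          rw [h, ih ⟨w - 1, hk⟩ (i + 1) (by dsimp only; omega)]
          congr 1
          dsimp only
          omega
    have hq' : ∀ (w : W) (i : ℤ), q i w = q (i + w.1) ⟨0, h0⟩ := fun w i => hwin _ w i rfl
    have hz : (fun i => q i ⟨0, h0⟩) ∈ shiftOf F := by
      rintro P hP ⟨t, ht⟩
      exact (hq t).2.1 P hP fun w => (hq' _ t).trans (ht w)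
    refine ⟨_, hz, ?_⟩
    funext i
    rw [hΦ _ hz i, (hq i).2.2]
    congr 1
    funext w
    exact (hq' ⟨w.1, hND w.1 w.2⟩ i).symm

/-- For shifts presented by finite graphs, membership in the universal extension means that every
filling of the holes by a configuration of `Y` is in `X`. -/
theorem mem_univExt_graphShift_iff {Q Q' S : Type*} [Finite Q] {R : Q → S → Q → Prop}
    {R' : Q' → S → Q' → Prop} {z : ℤ → Option S} :
    z ∈ univExt (graphShift R) (graphShift R') ↔
      ∀ y ∈ graphShift R', (fun i => (z i).getD (y i)) ∈ graphShift R := by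
  constructor
  · intro hz y hy
    apply mem_graphShift_of_forall_block
    intro n
    have hn : fill (⟨Finset.Icc (-n : ℤ) n, fun w => z w.1⟩ : Pattern ℤ (Option S))
        (fun w => y w.1) ∈ lang (graphShift R) := by
      by_contra hcon
      refine hz ⟨Finset.Icc (-n : ℤ) n, fun w => z w.1⟩ ⟨fun w => y w.1, ?_, hcon⟩
        ⟨0, fun w => by simp⟩
      exact ⟨y, hy, 0, fun w => by simp⟩
    obtain ⟨x, ⟨q, hq⟩, t, ht⟩ := hn
    refine ⟨fun i => q (i + t), fun i h₁ h₂ => ?_⟩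
    have e : x (t + i) = (z i).getD (y i) := ht ⟨i, Finset.mem_Icc.2 ⟨h₁, h₂.le⟩⟩
    have := hq.shift t i
    simp only [add_comm i t, e] at this
    simpa only [add_comm i t] using this
  · rintro h P ⟨Q, ⟨y, hy, t', ht'⟩, hQ⟩ ⟨t, ht⟩
    refine hQ ⟨_, h _ (shift_mem_graphShift hy (t' - t)), t, fun w => ?_⟩
    have e : y (t + w.1 + (t' - t)) = Q w := by
      have := ht' w
      rwa [show t' + w.1 = t + w.1 + (t' - t) by ring] at this
    change (z (t + w.1)).getD (y (t + w.1 + (t' - t))) = (P.2 w).getD (Q w)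
    rw [e, ht w]

/-- The states reachable from `B` by an edge labelled `s`. -/
def stepSet {Q S : Type*} (R : Q → S → Q → Prop) (B : Set Q) (s : S) : Set Q :=
  {v | ∃ u ∈ B, R u s v}

/-- The end states of paths labelled by the block of `x` of length `n` starting at `i`. -/
def reach {Q S : Type*} (R : Q → S → Q → Prop) (x : ℤ → S) (i : ℤ) : ℕ → Set Q
  | 0 => Set.univ
  | n + 1 => stepSet R (reach R x i n) (x (i + n))

theorem reach_congr {Q S : Type*} {R : Q → S → Q → Prop} {x x' : ℤ → S} {i : ℤ} {n : ℕ}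
    (h : ∀ j, j < i + n → x j = x' j) : reach R x i n = reach R x' i n := by
  induction n with
  | zero => rfl
  | succ n ih =>
    rw [reach, reach, ih fun j hj => h j (by push_cast; omega), h (i + n) (by push_cast; omega)]

theorem IsRun.mem_reach {Q S : Type*} {R : Q → S → Q → Prop} {x : ℤ → S} {q : ℤ → Q}
    (h : IsRun R x q) (i : ℤ) (n : ℕ) : q (i + n) ∈ reach R x i n := by
  induction n with
  | zero => trivial
  | succ n ih =>
    refine ⟨_, ih, ?_⟩
    have := h (i + n)
    rwa [add_assoc, ← Nat.cast_succ] at this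

theorem exists_path_of_mem_reach {Q S : Type*} {R : Q → S → Q → Prop} {x : ℤ → S} {i : ℤ}
    {n : ℕ} {v : Q} (h : v ∈ reach R x i n) :
    ∃ q : ℤ → Q, q (i + n) = v ∧ ∀ j, i ≤ j → j < i + n → R (q j) (x j) (q (j + 1)) := by
  induction n generalizing v with
  | zero => exact ⟨fun _ => v, rfl, fun j h₁ h₂ => by simp at h₂; omega⟩
  | succ n ih =>
    obtain ⟨u, hu, hR⟩ := h
    obtain ⟨q, hqu, hq⟩ := ih hu
    refine ⟨fun j => if j ≤ i + n then q j else v, if_neg (by push_cast; omega), ?_⟩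
    intro j h₁ h₂
    push_cast at h₂
    rcases (show j ≤ i + n by omega).lt_or_eq with hlt | rfl
    · simpa only [if_pos hlt.le, if_pos (show j + 1 ≤ i + n by omega)] using hq j h₁ hlt
    · simpa only [if_pos le_rfl, if_neg (show ¬ i + n + 1 ≤ i + n by omega), hqu] using hR

/-- Two bi-infinite paths through a common state can be spliced there. -/
theorem IsRun.splice {Q S : Type*} {R : Q → S → Q → Prop} {x x' : ℤ → S} {q q' : ℤ → Q}
    (hq : IsRun R x q) (hq' : IsRun R x' q') {i : ℤ} (hi : q i = q' i) :
    IsRun R (fun j => if j < i then x j else x' j) (fun j => if j < i then q j else q' j) := by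
  intro j
  rcases lt_or_ge j i with hj | hj
  · rcases (show j + 1 ≤ i by omega).lt_or_eq with hlt | heq
    · simpa only [if_pos hj, if_pos hlt] using hq j
    · have := hq j
      rw [heq, hi] at this
      simpa only [if_pos hj, heq, lt_irrefl, if_false] using this
  · have hlast := hq' j
    simpa only [if_neg hj.not_gt, if_neg (show ¬ j + 1 < i by omega)] using hlast

/-- Edges of `R` that lie on a bi-infinite path. -/
def EssentialEdge {Q S : Type*} (R : Q → S → Q → Prop) (p : Q) (s : S) (r : Q) : Prop :=
  ∃ x q, IsRun R x q ∧ q 0 = p ∧ x 0 = s ∧ q 1 = r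

/-- The graph presenting the universal extension of the shifts presented by `R` and `R'`. Its
states record, for paths of `R'`, the states of `R` reachable along the filled labels. -/
def univExtGraph {Q Q' S : Type*} (R : Q → S → Q → Prop) (R' : Q' → S → Q' → Prop)
    (A : Set (Q' × Set Q)) (a : Option S) (A' : Set (Q' × Set Q)) : Prop :=
  ∀ p s p', EssentialEdge R' p s p' → (p, Set.univ) ∈ A ∧
    ∀ B, (p, B) ∈ A → B.Nonempty ∧ (p', stepSet R B (a.getD s)) ∈ A'

theorem univExt_graphShift {Q Q' S : Type*} [Finite Q] (R : Q → S → Q → Prop)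
    (R' : Q' → S → Q' → Prop) :
    univExt (graphShift R) (graphShift R') = graphShift (univExtGraph R R') := by
  ext z
  rw [mem_univExt_graphShift_iff]
  constructor
  · intro h
    refine ⟨fun i => {b | ∃ (n : ℕ) (y : ℤ → S) (q : ℤ → Q'), IsRun R' y q ∧ q i = b.1 ∧
      b.2 = reach R (fun j => (z j).getD (y j)) (i - n) n}, ?_⟩
    rintro i p s p' ⟨y₀, q₀, hrun₀, rfl, rfl, rfl⟩
    have hrun := hrun₀.shift (-i)
    refine ⟨⟨0, _, _, hrun, by simp, rfl⟩, ?_⟩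
    rintro _ ⟨n, y, q, hq, hqi, rfl⟩
    dsimp only at hqi
    constructor
    · obtain ⟨r, hr⟩ := h y ⟨q, hq⟩
      exact ⟨_, hr.mem_reach _ _⟩
    · refine ⟨n + 1, _, _, hq.splice hrun (i := i) (by simpa using hqi), ?_, ?_⟩
      · simp
      · have e : i + 1 - ((n + 1 : ℕ) : ℤ) = i - n := by push_cast; ring
        dsimp only
        rw [e, reach]
        congr 1
        · apply reach_congr
          intro j hj
          rw [if_pos (by omega)]
        · simp
  · rintro ⟨A, hA⟩ y ⟨p, hp⟩
    have hE : ∀ i, EssentialEdge R' (p i) (y i) (p (i + 1)) := fun i =>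
      ⟨_, _, hp.shift i, by simp, by simp, by simp [add_comm]⟩
    have hmem : ∀ (i : ℤ) (n : ℕ),
        (p (i + n), reach R (fun j => (z j).getD (y j)) i n) ∈ A (i + n) := by
      intro i n
      induction n with
      | zero => simpa [reach] using (hA i _ _ _ (hE i)).1
      | succ n ih =>
        have := ((hA _ _ _ _ (hE (i + n))).2 _ ih).2
        rwa [add_assoc, ← Nat.cast_succ] at this
    apply mem_graphShift_of_forall_block
    intro n
    obtain ⟨v, hv⟩ := ((hA _ _ _ _ (hE _)).2 _ (hmem (-n) (2 * n))).1
    obtain ⟨q, -, hq⟩ := exists_path_of_mem_reach hv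
    exact ⟨q, fun i h₁ h₂ => hq i h₁ (by push_cast; omega)⟩

/-- If `X, Y ⊆ S^ℤ` are one-dimensional sofic shifts, then the
universal extension `A(X,Y)` is a sofic shift. -/
theorem stmt3 (S : Type) [Fintype S]
    (X Y : Set (ℤ → S)) (hX : IsSofic X) (hY : IsSofic Y) :
    IsSofic (univExt X Y) := by
  obtain ⟨Q, _, R, rfl⟩ := hX.exists_graphShift
  obtain ⟨Q', _, R', rfl⟩ := hY.exists_graphShift
  rw [univExt_graphShift]
  exact isSofic_graphShift _

end QE
end

section
/- There exist a finite alphabet S and countable two-dimensional sofic shifts X, Y ⊆ S^{ℤ²} such that the language of the universal extension A(X,Y) is Π⁰₂-complete. -/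
namespace QE

variable {V S T : Type*}

/-- Coding of finite patterns in `ℤ²` by lists of (position, symbol) pairs:
`codesFor2 c P` says the list `c` is a code of the pattern `P`. -/
def codesFor2 {S : Type*} (c : List ((ℤ × ℤ) × S)) (P : Pattern (ℤ × ℤ) S) : Prop :=
  P.1 = (c.map Prod.fst).toFinset ∧
  ∀ p ∈ c, ∀ h : p.1 ∈ P.1, P.2 ⟨p.1, h⟩ = p.2

/-- A set of natural numbers is `Π⁰₂` if it is of the form `{k | ∀ m, ∃ n, R k m n}`
for a computable (decidable) relation `R`. -/
def PiTwoNat (N : Set ℕ) : Prop :=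
  ∃ R : ℕ → ℕ → ℕ → Bool,
    Computable (fun p : ℕ × ℕ × ℕ => R p.1 p.2.1 p.2.2) ∧
    ∀ k : ℕ, k ∈ N ↔ ∀ m : ℕ, ∃ n : ℕ, R k m n = true

/-- The set of natural-number codes of the patterns in a set `A` of two-dimensional
patterns over the alphabet `Option (Fin s)`. -/
def patCodes (s : ℕ) (A : Set (Pattern (ℤ × ℤ) (Option (Fin s)))) : Set ℕ :=
  {k | ∃ c : List ((ℤ × ℤ) × Option (Fin s)),
    Encodable.encode c = k ∧ ∃ P ∈ A, codesFor2 c P}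

section

/-- The set of pairs `(K, m)` on which the universal partial recursive function is defined. -/
def Halts (K m : ℕ) : Prop :=
  (Nat.Partrec.Code.eval (Denumerable.ofNat Nat.Partrec.Code K.unpair.1)
    (Nat.pair K.unpair.2 m)).Dom

/-- Elementary stack operations. -/
inductive StackOp (Γ : Type) : Type
  | stay : StackOp Γ
  | pop : StackOp Γ
  | push : Γ → StackOp Γ

/-- The effect of an operation on a stack whose top is at position `0`. -/
def StackOp.apply {Γ : Type} : StackOp Γ → (ℕ → Option Γ) → ℕ → Option Γ
  | .stay, s, n => s n
  | .pop, s, n => s (n + 1)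
  | .push γ, _, 0 => some γ
  | .push _, s, n + 1 => s n

/-- One step of a multi-stack machine whose control sees the top of every stack. -/
def cfgStep {Q K Γ : Type} (δ : Q → (K → Option Γ) → Option (Q × (K → StackOp Γ)))
    (c : Q × (K → ℕ → Option Γ)) : Option (Q × (K → ℕ → Option Γ)) :=
  (δ c.1 fun k => c.2 k 0).map fun r => (r.1, fun k => (r.2 k).apply (c.2 k))

open Turing Turing.PartrecToTM2 StateTransition

instance : Fintype K' :=
  ⟨{K'.main, K'.rev, K'.aux, K'.stack}, by rintro (_ | _ | _ | _) <;> decide⟩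

/-- Single-operation semantics of the stack statements. -/
def opStep : Option Stmt' → Option Γ' → (K' → Option Γ') →
    Option ((Option Stmt' × Option Γ') × (K' → StackOp Γ'))
  | some (.push k f q), v, _ =>
      some ((some q, v), fun k' => if k' = k then .push (f v) else .stay)
  | some (.peek k f q), v, t => some ((some q, f v (t k)), fun _ => .stay)
  | some (.pop k f q), v, t =>
      some ((some q, f v (t k)), fun k' => if k' = k then .pop else .stay)
  | some (.load a q), v, _ => some ((some q, a v), fun _ => .stay)
  | some (.branch p q₁ q₂), v, _ =>
      some ((some (cond (p v) q₁ q₂), v), fun _ => .stay)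
  | some (.goto l), v, _ => some ((some (tr (l v)), v), fun _ => .stay)
  | some .halt, v, _ => some ((none, v), fun _ => .stay)
  | none, _, _ => none

theorem some_tr_mem_stmts {S : Finset Λ'} {l : Λ'} (hl : l ∈ S) :
    some (tr l) ∈ TM2.stmts tr S := by
  classical
  exact Finset.some_mem_insertNone.2 (Finset.mem_biUnion.2 ⟨l, hl, TM2.stmts₁_self⟩)

theorem opStep_mem_stmts {S : Finset Λ'} {i : Inhabited Λ'} (hS : TM2.Supports tr S)
    {o : Option Stmt'} (ho : o ∈ TM2.stmts tr S) {v t r} (h : opStep o v t = some r) :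
    r.1.1 ∈ TM2.stmts tr S := by
  rcases o with _ | q
  · simp [opStep] at h
  have hs := TM2.stmts_supportsStmt hS ho
  cases q with
  | goto l =>
    simp only [opStep, Option.some.injEq] at h
    subst h
    exact some_tr_mem_stmts (hs v)
  | halt =>
    simp only [opStep, Option.some.injEq] at h
    subst h
    exact Finset.none_mem_insertNone
  | branch p q₁ q₂ =>
    simp only [opStep, Option.some.injEq] at h
    subst h
    refine TM2.stmts_trans ?_ ho
    have h1 := TM2.stmts₁_self (q := q₁)
    have h2 := TM2.stmts₁_self (q := q₂)
    cases hp : p v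
    · show q₂ ∈ _
      classical
      exact Finset.mem_insert_of_mem (Finset.mem_union_right _ h2)
    · show q₁ ∈ _
      classical
      exact Finset.mem_insert_of_mem (Finset.mem_union_left _ h1)
  | push k f q | peek k f q | pop k f q | load f q =>
    simp only [opStep, Option.some.injEq] at h
    subst h
    refine TM2.stmts_trans ?_ ho
    have h1 := TM2.stmts₁_self (q := q)
    simp [TM2.stmts₁, h1]

open Classical in
/-- The control of the stack machine, restricted to the accessible statements. -/
noncomputable def opControl (A : Finset (Option Stmt')) (q : {o // o ∈ A} × Option Γ')
    (t : K' → Option Γ') : Option (({o // o ∈ A} × Option Γ') × (K' → StackOp Γ')) :=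
  (opStep q.1.1 q.2 t).bind fun r =>
    if h : r.1.1 ∈ A then some ((⟨r.1.1, h⟩, r.1.2), r.2) else none

/-- Stacks given as lists, viewed as functions. -/
def stackFun (S : K' → List Γ') : K' → ℕ → Option Γ' := fun k n => (S k)[n]?

theorem cfgStep_opControl {A : Finset (Option Stmt')} {o o' : {o // o ∈ A}} {v v' : Option Γ'}
    {S S' : K' → List Γ'} {ops : K' → StackOp Γ'}
    (h : opStep o.1 v (fun k => (S k).head?) = some ((o'.1, v'), ops))
    (hops : ∀ k, (ops k).apply (stackFun S k) = stackFun S' k) :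
    cfgStep (opControl A) ((o, v), stackFun S) = some ((o', v'), stackFun S') := by
  have ht : (fun k => stackFun S k 0) = fun k => (S k).head? := by
    funext k; simp [stackFun, List.head?_eq_getElem?]
  simp [cfgStep, opControl, ht, h, hops, o'.2]

theorem reaches_stepAux {S : Finset Λ'} {i : Inhabited Λ'} (hS : TM2.Supports tr S)
    (q : Stmt') (hq : some q ∈ TM2.stmts tr S) (v : Option Γ') (L : K' → List Γ') :
    ∃ o : {o // o ∈ TM2.stmts tr S}, o.1 = (TM2.stepAux q v L).l.map tr ∧
      Reaches₁ (cfgStep (opControl (TM2.stmts tr S))) ((⟨some q, hq⟩, v), stackFun L)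
        ((o, (TM2.stepAux q v L).var), stackFun (TM2.stepAux q v L).stk) := by
  have mem := fun {o v t r} => opStep_mem_stmts hS (o := o) (v := v) (t := t) (r := r)
  induction q generalizing v L with
  | goto l =>
    refine ⟨⟨some (tr (l v)), mem (o := some (.goto l)) (v := v) (t := fun _ => none) hq rfl⟩, rfl,
      Relation.TransGen.single ?_⟩
    exact cfgStep_opControl rfl fun k => rfl
  | halt =>
    refine ⟨⟨none, mem (o := some .halt) (v := v) (t := fun _ => none) hq rfl⟩, rfl,
      Relation.TransGen.single ?_⟩
    exact cfgStep_opControl rfl fun k => rfl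
  | branch p q₁ q₂ ih₁ ih₂ =>
    have hm := mem (o := some (.branch p q₁ q₂)) (v := v) (t := fun _ => none) hq rfl
    have hst : cfgStep (opControl (TM2.stmts tr S)) ((⟨_, hq⟩, v), stackFun L) =
        some ((⟨_, hm⟩, v), stackFun L) := cfgStep_opControl rfl fun k => rfl
    have haux : TM2.stepAux (.branch p q₁ q₂) v L = TM2.stepAux (cond (p v) q₁ q₂) v L := by
      cases hp : p v <;> simp [TM2.stepAux, hp]
    have key : ∃ o : {o // o ∈ TM2.stmts tr S},
        o.1 = (TM2.stepAux (cond (p v) q₁ q₂) v L).l.map tr ∧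
        Reaches₁ (cfgStep (opControl (TM2.stmts tr S))) ((⟨_, hm⟩, v), stackFun L)
          ((o, (TM2.stepAux (cond (p v) q₁ q₂) v L).var),
            stackFun (TM2.stepAux (cond (p v) q₁ q₂) v L).stk) := by
      clear hst haux
      revert hm
      cases p v
      · exact fun hm => ih₂ hm v L
      · exact fun hm => ih₁ hm v L
    rw [haux]
    obtain ⟨o, h1, h2⟩ := key
    exact ⟨o, h1, Relation.TransGen.head hst h2⟩
  | load a q ih =>
    have hm := mem (o := some (.load a q)) (v := v) (t := fun _ => none) hq rfl
    obtain ⟨o, h1, h2⟩ := ih hm (a v) L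
    exact ⟨o, h1, Relation.TransGen.head (cfgStep_opControl rfl fun k => rfl) h2⟩
  | peek k f q ih =>
    have hm := mem (o := some (.peek k f q)) (v := v) (t := fun _ => none) hq rfl
    obtain ⟨o, h1, h2⟩ := ih hm (f v (L k).head?) L
    exact ⟨o, h1, Relation.TransGen.head (cfgStep_opControl rfl fun k => rfl) h2⟩
  | pop k f q ih =>
    have hm := mem (o := some (.pop k f q)) (v := v) (t := fun _ => none) hq rfl
    obtain ⟨o, h1, h2⟩ := ih hm (f v (L k).head?) (Function.update L k (L k).tail)
    refine ⟨o, h1, Relation.TransGen.head (cfgStep_opControl rfl fun k' => ?_) h2⟩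
    funext n
    by_cases hk : k' = k
    · subst hk; simp [stackFun, StackOp.apply]
    · simp [stackFun, StackOp.apply, hk]
  | push k f q ih =>
    have hm := mem (o := some (.push k f q)) (v := v) (t := fun _ => none) hq rfl
    obtain ⟨o, h1, h2⟩ := ih hm v (Function.update L k (f v :: L k))
    refine ⟨o, h1, Relation.TransGen.head (cfgStep_opControl rfl fun k' => ?_) h2⟩
    funext n
    by_cases hk : k' = k
    · subst hk; cases n <;> simp [stackFun, StackOp.apply]
    · simp [stackFun, StackOp.apply, hk]

/-- The initial content of the input stack coding `(2 ^ (k + 2) - 1, 2 ^ (m + 1) - 1)`. -/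
def inputWord (k m n : ℕ) : Option Γ' :=
  if n < k + 2 then some .bit1 else if n = k + 2 then some .cons else
  if n < k + m + 4 then some .bit1 else if n = k + m + 4 then some .cons else none

/-- The initial content of all stacks. -/
def inputStacks (k m : ℕ) (κ : K') (n : ℕ) : Option Γ' :=
  if κ = .main then inputWord k m n else none

theorem trNat_two_pow_sub_one (n : ℕ) : trNat (2 ^ n - 1) = List.replicate n Γ'.bit1 := by
  have key : ∀ n : ℕ, ∃ p : PosNum, ((2 ^ (n + 1) - 1 : ℕ) : Num) = Num.pos p ∧
      trPosNum p = List.replicate (n + 1) Γ'.bit1 := by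
    intro n
    induction n with
    | zero => exact ⟨1, rfl, rfl⟩
    | succ n ih =>
      obtain ⟨p, h1, h2⟩ := ih
      refine ⟨p.bit1, ?_, ?_⟩
      · have e : 2 ^ (n + 1 + 1) - 1 = 2 * (2 ^ (n + 1) - 1) + 1 := by
          have := Nat.one_le_two_pow (n := n + 1)
          rw [pow_succ 2 (n + 1)]; omega
        apply Num.to_nat_inj.1
        have h1' : ((2 ^ (n + 1) - 1 : ℕ)) = (p : ℕ) := by
          have := congrArg (fun x : Num => (x : ℕ)) h1
          simpa [-Nat.cast_sub] using this
        rw [e, h1']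
        simp [two_mul]
      · simp [trPosNum, h2, List.replicate_succ]
  rcases n with _ | n
  · exact trNat_zero
  · obtain ⟨p, h1, h2⟩ := key n
    rw [trNat, h1, trNum, h2]

theorem stackFun_input (k m : ℕ) :
    stackFun (K'.elim (trList [2 ^ (k + 2) - 1, 2 ^ (m + 1) - 1]) [] [] []) =
      inputStacks k m := by
  funext κ n
  cases κ
  case main =>
    simp only [stackFun, inputStacks, K'.elim, trList, trNat_two_pow_sub_one, if_true, inputWord]
    rw [List.getElem?_append]
    simp only [List.length_replicate, List.getElem?_replicate]
    split_ifs with h1 h2 h3 h4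
    · rfl
    · subst h2; simp
    · obtain ⟨d, rfl⟩ : ∃ d, n = k + 2 + (d + 1) := ⟨n - (k + 3), by omega⟩
      rw [Nat.add_sub_cancel_left, List.getElem?_cons_succ]
      rw [List.getElem?_append_left (by rw [List.length_replicate]; omega),
        List.getElem?_replicate, if_pos (by omega)]
    · subst h4
      have : k + m + 4 - (k + 2) = (m + 1) + 1 := by omega
      rw [this, List.getElem?_cons_succ, List.getElem?_append_right (by simp)]
      simp
    · obtain ⟨d, rfl⟩ : ∃ d, n = k + 2 + (d + 1) := ⟨n - (k + 3), by omega⟩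
      rw [Nat.add_sub_cancel_left, List.getElem?_cons_succ]
      rw [List.getElem?_append_right (by simp; omega)]
      simp; omega
  all_goals simp [stackFun, inputStacks, K'.elim]

/-- A primitive recursive base-two logarithm of the successor. -/
theorem primrec_log_succ : Primrec fun x : ℕ => Nat.log 2 (x + 1) := by
  have hpow : Primrec fun n : ℕ => 2 ^ n := by
    have : Primrec fun n : ℕ => (Nat.rec 1 (fun _ b => b + b) n : ℕ) :=
      Primrec.nat_rec₁ 1 (Primrec.nat_add.comp Primrec.snd Primrec.snd)
    refine this.of_eq fun n => ?_
    induction n with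
    | zero => rfl
    | succ n ih => simp only [ih]; ring
  have : Primrec fun n : ℕ =>
      (Nat.rec 0 (fun y b => if 2 ^ (b + 1) ≤ y + 2 then b + 1 else b) n : ℕ) := by
    refine Primrec.nat_rec₁ 0 (Primrec.ite ?_ ?_ Primrec.snd)
    · exact Primrec.nat_le.comp (hpow.comp (Primrec.succ.comp Primrec.snd))
        (Primrec.nat_add.comp Primrec.fst (Primrec.const 2))
    · exact Primrec.succ.comp Primrec.snd
  refine this.of_eq fun n => ?_
  induction n with
  | zero => simp
  | succ n ih =>
    simp only [ih]
    have h1 := Nat.pow_log_le_self 2 (x := n + 1) (by omega)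
    have h2 := Nat.lt_pow_succ_log_self (b := 2) (by omega) (n + 1)
    have h3 : 2 ^ (Nat.log 2 (n + 1)).succ = 2 * 2 ^ (Nat.log 2 (n + 1)) := by rw [pow_succ]; ring
    split_ifs with h
    · refine (Nat.log_eq_of_pow_le_of_lt_pow (m := Nat.log 2 (n + 1) + 1) h ?_).symm
      rw [pow_succ]
      have : 2 ^ (Nat.log 2 (n + 1) + 1) = 2 * 2 ^ (Nat.log 2 (n + 1)) := by rw [pow_succ]; ring
      simp only [Nat.succ_eq_add_one] at *
      omega
    · exact (Nat.log_eq_of_pow_le_of_lt_pow (by omega) (by omega)).symm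

theorem exists_code_halts : ∃ c : ToPartrec.Code, ∀ k m : ℕ,
    (c.eval [2 ^ (k + 2) - 1, 2 ^ (m + 1) - 1]).Dom ↔ Halts k m := by
  have hU : Partrec₂ fun x y : ℕ => Nat.Partrec.Code.eval
      (Denumerable.ofNat Nat.Partrec.Code (Nat.log 2 (x + 1) - 2).unpair.1)
      (Nat.pair (Nat.log 2 (x + 1) - 2).unpair.2 (Nat.log 2 (y + 1) - 1)) := by
    have hx : Primrec fun p : ℕ × ℕ => (Nat.log 2 (p.1 + 1) - 2).unpair :=
      Primrec.unpair.comp (Primrec.nat_sub.comp (primrec_log_succ.comp Primrec.fst)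
        (Primrec.const 2))
    have hy : Primrec fun p : ℕ × ℕ => Nat.log 2 (p.2 + 1) - 1 :=
      Primrec.nat_sub.comp (primrec_log_succ.comp Primrec.snd) (Primrec.const 1)
    exact Nat.Partrec.Code.eval_part.comp
      (((Primrec.ofNat Nat.Partrec.Code).comp (Primrec.fst.comp hx)).to_comp)
      ((Primrec₂.natPair.comp (Primrec.snd.comp hx) hy).to_comp)
  obtain ⟨c, hc⟩ := ToPartrec.Code.exists_code (Nat.Partrec'.part_iff₂.2 hU)
  refine ⟨c, fun k m => ?_⟩
  have h := hc ((2 ^ (k + 2) - 1) ::ᵥ (2 ^ (m + 1) - 1) ::ᵥ List.Vector.nil)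
  have e1 : 2 ^ (k + 2) - 1 + 1 = 2 ^ (k + 2) := Nat.sub_add_cancel Nat.one_le_two_pow
  have e2 : 2 ^ (m + 1) - 1 + 1 = 2 ^ (m + 1) := Nat.sub_add_cancel Nat.one_le_two_pow
  have hv : ((2 ^ (k + 2) - 1) ::ᵥ (2 ^ (m + 1) - 1) ::ᵥ List.Vector.nil : List.Vector ℕ 2).1 =
    [2 ^ (k + 2) - 1, 2 ^ (m + 1) - 1] := rfl
  rw [hv] at h
  rw [h]
  simp only [List.Vector.head_cons, List.Vector.tail_cons, e1, e2, Nat.log_pow (by omega : 1 < 2),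
    Nat.add_sub_cancel, Halts]
  rfl

/-- A fixed finite stack machine halts on the unary input `(k, m)` exactly if `Halts k m`. -/
theorem exists_stackMachine : ∃ (Q : Type) (_ : Fintype Q) (q₀ : Q)
    (δ : Q → (K' → Option Γ') → Option (Q × (K' → StackOp Γ'))),
    ∀ k m : ℕ, (eval (cfgStep δ) (q₀, inputStacks k m)).Dom ↔ Halts k m := by
  obtain ⟨c, hc⟩ := exists_code_halts
  have hS := tr_supports c Cont'.halt
  set i : Inhabited Λ' := ⟨trNormal c Cont'.halt⟩
  set S := codeSupp c Cont'.halt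
  let A := TM2.stmts tr S
  let R : Cfg' → ({o // o ∈ A} × Option Γ') × (K' → ℕ → Option Γ') → Prop := fun a b =>
    b.1.1.1 = a.l.map tr ∧ b.1.2 = a.var ∧ b.2 = stackFun a.stk ∧ ∀ l, a.l = some l → l ∈ S
  have hR : Respects (TM2.step tr) (cfgStep (opControl A)) R := by
    rintro ⟨_ | l, v, L⟩ ⟨⟨⟨o, ho⟩, v'⟩, st⟩ ⟨h1, h2, h3, h4⟩
    · simp only [Option.map_none] at h1
      subst h1
      simp [TM2.step, cfgStep, opControl, opStep]
    · simp only [Option.map_some] at h1 h2 h3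
      subst h1 h2 h3
      obtain ⟨o, h5, h6⟩ := reaches_stepAux hS _ ho v' L
      refine ⟨_, ⟨h5, rfl, rfl, fun l' hl' => ?_⟩, h6⟩
      have h7 := TM2.step_supports tr hS (c := ⟨some l, v', L⟩)
        (c' := TM2.stepAux (tr l) v' L) rfl (Finset.some_mem_insertNone.2 (h4 l rfl))
      rw [hl'] at h7
      exact Finset.some_mem_insertNone.1 h7
  refine ⟨{o // o ∈ A} × Option Γ', inferInstance, (⟨_, some_tr_mem_stmts hS.1⟩, none), opControl A,
    fun k m => ?_⟩
  rw [← hc, ← stackFun_input]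
  refine (tr_eval_dom hR (a₁ := init c [2 ^ (k + 2) - 1, 2 ^ (m + 1) - 1])
    ⟨rfl, rfl, rfl, ?_⟩).trans ?_
  · intro l hl
    cases hl
    exact hS.1
  · rw [PartrecToTM2.tr_eval]; rfl

end

/-- The symbol-to-symbol image of the configurations obeying a local rule that looks at the
right, left and upper neighbours is sofic. -/
theorem isSofic_of_localRule {S T' : Type} [Fintype T'] (ok : T' → T' → T' → T' → Prop)
    (π : T' → S) :
    IsSofic {x : ℤ × ℤ → S | ∃ z : ℤ × ℤ → T',
      (∀ i j, ok (z (i, j)) (z (i + 1, j)) (z (i - 1, j)) (z (i, j + 1))) ∧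
      x = fun t => π (z t)} := by
  classical
  let D : Finset (ℤ × ℤ) := {(0, 0), (1, 0), (-1, 0), (0, 1)}
  let B : ({v // v ∈ D} → T') → Prop := fun f =>
    ¬ ok (f ⟨(0, 0), by simp [D]⟩) (f ⟨(1, 0), by simp [D]⟩) (f ⟨(-1, 0), by simp [D]⟩)
      (f ⟨(0, 1), by simp [D]⟩)
  let F : Set (Pattern (ℤ × ℤ) T') := Set.range fun f : {f // B f} => ⟨D, f.1⟩
  refine ⟨T', inferInstance, shiftOf F, fun z t => π (z t), ⟨F, Set.finite_range _, rfl⟩,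
    ⟨{(0, 0)}, fun f => π (f ⟨(0, 0), by simp⟩), fun z _ t =>
      congrArg (fun u => π (z u)) (add_zero t).symm⟩, ?_⟩
  have hF : ∀ z : ℤ × ℤ → T', z ∈ shiftOf F ↔
      ∀ i j, ok (z (i, j)) (z (i + 1, j)) (z (i - 1, j)) (z (i, j + 1)) := by
    intro z
    constructor
    · intro hz i j
      by_contra hb
      refine hz ⟨D, fun w => z ((i, j) + w.1)⟩ ⟨⟨fun w => z ((i, j) + w.1), ?_⟩, rfl⟩
        ⟨(i, j), fun w => rfl⟩
      simpa [B, sub_eq_add_neg] using hb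
    · rintro hz _ ⟨⟨f, hf⟩, rfl⟩ ⟨⟨i, j⟩, ht⟩
      apply hf
      have h := hz i j
      simp only at ht
      rw [← ht, ← ht, ← ht, ← ht]
      simpa [sub_eq_add_neg] using h
  ext x
  constructor
  · rintro ⟨z, hz, rfl⟩
    exact ⟨z, (hF z).1 hz, rfl⟩
  · rintro ⟨z, hz, rfl⟩
    exact ⟨z, (hF z).2 hz, rfl⟩

/-- The square box of radius `n`. -/
noncomputable def box (n : ℕ) : Finset (ℤ × ℤ) := Finset.Icc (-n : ℤ) n ×ˢ Finset.Icc (-n : ℤ) n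

theorem mem_box {n : ℕ} {p : ℤ × ℤ} :
    p ∈ box n ↔ (-n ≤ p.1 ∧ p.1 ≤ n) ∧ -n ≤ p.2 ∧ p.2 ≤ n := by
  simp [box]

theorem box_mono {m n : ℕ} (h : m ≤ n) : box m ⊆ box n := by
  intro p hp
  rw [mem_box] at *
  omega

theorem exists_subset_box (D : Finset (ℤ × ℤ)) : ∃ n, D ⊆ box n := by
  classical
  induction D using Finset.induction_on with
  | empty => exact ⟨0, by simp⟩
  | insert a D _ ih =>
    obtain ⟨n, hn⟩ := ih
    refine ⟨n + a.1.natAbs + a.2.natAbs, Finset.insert_subset ?_ (hn.trans (box_mono (by omega)))⟩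
    rw [mem_box]
    omega

/-- All fillings of `x` by configurations of `Y` look admissible for `X` in the box of radius
`n`. -/
def FillsTo {S : Type*} (X Y : Set (ℤ × ℤ → S)) (n : ℕ) (x : ℤ × ℤ → Option S) : Prop :=
  ∀ y ∈ Y, ∃ x' ∈ X, ∀ p ∈ box n, x' p = (x p).getD (y p)

theorem mem_univExt_iff {S : Type*} {X Y : Set (ℤ × ℤ → S)}
    (hX : ∀ x ∈ X, ∀ t, (fun u => x (t + u)) ∈ X) (hY : ∀ y ∈ Y, ∀ t, (fun u => y (t + u)) ∈ Y)
    (x : ℤ × ℤ → Option S) : x ∈ univExt X Y ↔ ∀ n, FillsTo X Y n x := by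
  classical
  constructor
  · intro hx n y hy
    by_contra hc
    refine hx ⟨box n, fun w => x w.1⟩ ⟨fun w => y w.1, ⟨y, hy, 0, fun w => by simp⟩, ?_⟩
      ⟨0, fun w => by simp⟩
    rintro ⟨x', hx', t, ht⟩
    exact hc ⟨_, hX x' hx' t, fun p hp => ht ⟨p, hp⟩⟩
  · rintro hx P ⟨Q, ⟨y, hy, u, hu⟩, hQ⟩ ⟨t, ht⟩
    apply hQ
    obtain ⟨n, hn⟩ := exists_subset_box (P.1.image (t + ·))
    obtain ⟨x', hx', h⟩ := hx n _ (hY y hy (u - t))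
    refine ⟨x', hx', t, fun w => ?_⟩
    have h1 := h (t + w.1) (hn (Finset.mem_image_of_mem _ w.2))
    rw [h1, ht w]
    show _ = (P.2 w).getD (Q w)
    have h2 : y (u + w.1) = Q w := hu w
    rw [← h2]
    congr 2
    abel

theorem univExt_shift {S : Type*} {X Y : Set (ℤ × ℤ → S)} {x : ℤ × ℤ → Option S}
    (hx : x ∈ univExt X Y) (t : ℤ × ℤ) : (fun u => x (t + u)) ∈ univExt X Y := by
  rintro P hP ⟨u, hu⟩
  exact hx P hP ⟨t + u, fun w => by rw [add_assoc]; exact hu w⟩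

theorem encode_mem_patCodes {s : ℕ} {X Y : Set (ℤ × ℤ → Fin s)}
    (c : List ((ℤ × ℤ) × Option (Fin s))) :
    Encodable.encode c ∈ patCodes s (lang (univExt X Y)) ↔
      ∃ x ∈ univExt X Y, ∀ p ∈ c, x p.1 = p.2 := by
  constructor
  · rintro ⟨c', hc', P, ⟨x, hx, t, ht⟩, h1, h2⟩
    obtain rfl := Encodable.encode_injective hc'
    refine ⟨_, univExt_shift hx t, fun p hp => ?_⟩
    have hm : p.1 ∈ P.1 := by
      rw [h1, List.mem_toFinset]
      exact List.mem_map_of_mem hp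
    rw [← h2 p hp hm]
    exact ht ⟨p.1, hm⟩
  · rintro ⟨x, hx, h⟩
    exact ⟨c, rfl, ⟨_, fun w => x w.1⟩, ⟨x, hx, 0, fun w => by simp⟩, rfl, fun p hp _ => h p hp⟩

theorem encode_mem_patCodes_iff {s : ℕ} {X Y : Set (ℤ × ℤ → Fin s)}
    (hX : ∀ x ∈ X, ∀ t, (fun u => x (t + u)) ∈ X) (hY : ∀ y ∈ Y, ∀ t, (fun u => y (t + u)) ∈ Y)
    (c : List ((ℤ × ℤ) × Option (Fin s))) :
    Encodable.encode c ∈ patCodes s (lang (univExt X Y)) ↔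
      ∀ n, ∃ x, (∀ p ∈ c, p.1 ∈ box n → x p.1 = p.2) ∧ FillsTo X Y n x := by
  rw [encode_mem_patCodes]
  constructor
  · rintro ⟨x, hx, h⟩ n
    exact ⟨x, fun p hp _ => h p hp, (mem_univExt_iff hX hY x).1 hx n⟩
  · intro h
    let _ : TopologicalSpace (Option (Fin s)) := ⊥
    have : DiscreteTopology (Option (Fin s)) := ⟨rfl⟩
    let C : ℕ → Set (ℤ × ℤ → Option (Fin s)) := fun n =>
      {x | (∀ p ∈ c, p.1 ∈ box n → x p.1 = p.2) ∧ FillsTo X Y n x}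
    have hclosed : ∀ n, IsClosed (C n) := by
      intro n
      let r : (ℤ × ℤ → Option (Fin s)) → ({p // p ∈ box n} → Option (Fin s)) := fun x p => x p.1
      have hr : Continuous r := by fun_prop
      have : C n = r ⁻¹' (r '' C n) := by
        refine subset_antisymm (Set.subset_preimage_image _ _) ?_
        rintro x ⟨x', ⟨h1, h2⟩, h3⟩
        have h4 : ∀ p ∈ box n, x' p = x p := fun p hp => congrFun h3 ⟨p, hp⟩
        refine ⟨fun p hp hb => by rw [← h4 _ hb]; exact h1 p hp hb, fun y hy => ?_⟩
        obtain ⟨z, hz, h5⟩ := h2 y hy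
        exact ⟨z, hz, fun p hp => by rw [h5 p hp, h4 p hp]⟩
      rw [this]
      exact (isClosed_discrete _).preimage hr
    obtain ⟨x, hx⟩ := IsCompact.nonempty_iInter_of_sequence_nonempty_isCompact_isClosed C
      (fun n x ⟨h1, h2⟩ => ⟨fun p hp hb => h1 p hp (box_mono n.le_succ hb), fun y hy => by
        obtain ⟨z, hz, h5⟩ := h2 y hy
        exact ⟨z, hz, fun p hp => h5 p (box_mono n.le_succ hp)⟩⟩)
      h (hclosed 0).isCompact hclosed
    rw [Set.mem_iInter] at hx
    refine ⟨x, (mem_univExt_iff hX hY x).2 fun n => (hx n).2, fun p hp => ?_⟩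
    obtain ⟨n, hn⟩ := exists_subset_box {p.1}
    exact (hx n).1 p hp (hn (Finset.mem_singleton_self _))

/-- One step of a phase sequence: odd phases last for exactly one position. -/
def PhaseStep (a b : ℕ) : Prop := b = a + 1 ∨ (b = a ∧ a % 2 = 0)

/-- Nondecreasing sequences of phases `0, …, m` increasing by at most one at every step, in which
every odd phase is left immediately. -/
def IsPhase (m : ℕ) (g : ℤ → ℕ) : Prop := ∀ i, g i ≤ m ∧ PhaseStep (g i) (g (i + 1))

namespace IsPhase

variable {m : ℕ} {g : ℤ → ℕ}

theorem le (hg : IsPhase m g) (i : ℤ) : g i ≤ m := (hg i).1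

theorem mono (hg : IsPhase m g) : Monotone g :=
  monotone_int_of_le_succ fun i => by
    have := (hg i).2
    unfold PhaseStep at this
    omega

theorem succ_of_odd (hg : IsPhase m g) {i : ℤ} (hi : g i % 2 = 1) : g (i + 1) = g i + 1 := by
  have := (hg i).2
  unfold PhaseStep at this
  omega

theorem lt_iff_of_odd (hg : IsPhase m g) {i : ℤ} (hi : g i % 2 = 1) (j : ℤ) :
    g i < g j ↔ i < j := by
  constructor
  · intro h
    by_contra hc
    have := hg.mono (not_lt.1 hc)
    omega
  · intro h
    have := hg.mono (show i + 1 ≤ j by omega)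
    have := hg.succ_of_odd hi
    omega

theorem le_iff_of_odd (hg : IsPhase m g) {i : ℤ} (hi : g i % 2 = 1) (j : ℤ) :
    g i ≤ g j ↔ i ≤ j := by
  constructor
  · intro h
    by_contra hc
    have h1 : j + 1 ≤ i := by omega
    have h2 := hg.mono h1
    have h3 := (hg j).2
    unfold PhaseStep at h3
    omega
  · exact fun h => hg.mono h

theorem eq_iff_of_odd (hg : IsPhase m g) {i : ℤ} (hi : g i % 2 = 1) (j : ℤ) :
    g j = g i ↔ j = i := by
  have h1 := hg.lt_iff_of_odd hi j
  have h2 := hg.le_iff_of_odd hi j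
  omega

theorem shift (hg : IsPhase m g) (t : ℤ) : IsPhase m fun i => g (t + i) := fun i => by
  have := hg (t + i)
  rwa [add_assoc] at this

theorem const {c : ℕ} (hc : c ≤ m) (h2 : c % 2 = 0) : IsPhase m fun _ => c :=
  fun _ => ⟨hc, Or.inr ⟨rfl, h2⟩⟩

/-- A finite word obeying the phase rules extends without creating new odd phases. -/
theorem exists_extend (hm : m % 2 = 0) {N : ℕ} (hN : 0 < N) (w : ℕ → ℕ) (hw : ∀ i < N, w i ≤ m)
    (hs : ∀ i, i + 1 < N → PhaseStep (w i) (w (i + 1))) (n : ℤ) :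
    ∃ g, IsPhase m g ∧ (∀ i < N, g (i - n) = w i) ∧
      ∀ z, g z % 2 = 1 → ∃ i < N, z = i - n := by
  refine ⟨fun z => if z < -n then w 0 / 2 * 2 else if z < N - n then w (z + n).toNat
    else (w (N - 1) + 1) / 2 * 2, fun z => ?_, fun i hi => ?_, fun z hz => ?_⟩
  · have h0 := hw 0 hN
    have h1 := hw (N - 1) (by omega)
    beta_reduce
    rcases lt_or_ge z (-n) with hz | hz
    · rw [if_pos hz]
      refine ⟨by omega, ?_⟩
      rcases lt_or_ge (z + 1) (-n) with hz' | hz'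
      · rw [if_pos hz']; unfold PhaseStep; omega
      · rw [if_neg (by omega), if_pos (by omega), show (z + 1 + n).toNat = 0 by omega]
        unfold PhaseStep; omega
    · rw [if_neg (by omega), if_neg (by omega : ¬ z + 1 < -n)]
      rcases lt_or_ge z (N - n) with hz1 | hz1
      · rw [if_pos hz1]
        refine ⟨hw _ (by omega), ?_⟩
        rcases lt_or_ge (z + 1) (N - n) with hz' | hz'
        · rw [if_pos hz', show (z + 1 + n).toNat = (z + n).toNat + 1 by omega]
          exact hs _ (by omega)
        · rw [if_neg (by omega), show (z + n).toNat = N - 1 by omega]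
          unfold PhaseStep; omega
      · rw [if_neg (by omega), if_neg (by omega)]
        refine ⟨by omega, ?_⟩
        unfold PhaseStep; omega
  · simp only
    rw [if_neg (by omega), if_pos (by omega), show ((i : ℤ) - n + n).toNat = i by omega]
  · simp only at hz
    split_ifs at hz with h1 h2
    · omega
    · exact ⟨(z + n).toNat, by omega, by omega⟩
    · omega

theorem countable (m : ℕ) : {g | IsPhase m g}.Countable := by
  classical
  let code : (ℤ → ℕ) → Fin (m + 1) → ℤ ⊕ Bool := fun g k =>
    if h : ∃ a, ∀ i, k.1 ≤ g i ↔ a ≤ i then .inl h.choose else .inr (decide (k.1 ≤ g 0))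
  have hconst : ∀ g, IsPhase m g → ∀ k : ℕ, (¬ ∃ a, ∀ i, k ≤ g i ↔ a ≤ i) →
      ∀ i, (k ≤ g i ↔ k ≤ g 0) := by
    intro g hg k hk
    by_contra hc
    push Not at hc
    apply hk
    have h1 : ∃ z, k ≤ g z := by
      obtain ⟨i, hi⟩ := hc
      by_cases h : k ≤ g i
      · exact ⟨i, h⟩
      · exact ⟨0, by omega⟩
    have h2 : ∃ z, ¬ k ≤ g z := by
      obtain ⟨i, hi⟩ := hc
      by_cases h : k ≤ g i
      · exact ⟨0, by omega⟩
      · exact ⟨i, h⟩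
    obtain ⟨b, hb⟩ := h2
    obtain ⟨a, ha, hmin⟩ := Int.exists_least_of_bdd (P := fun z => k ≤ g z)
      ⟨b, fun z hz => by
        by_contra hlt
        have := hg.mono (show z ≤ b by omega)
        omega⟩ h1
    exact ⟨a, fun i => ⟨hmin i, fun h => ha.trans (hg.mono h)⟩⟩
  refine Set.MapsTo.countable_of_injOn (f := code) (t := Set.univ) (fun _ _ => Set.mem_univ _)
    (fun g hg g' hg' h => ?_) (Set.to_countable _)
  have key : ∀ k ≤ m, ∀ i, k ≤ g i ↔ k ≤ g' i := by
    intro k hk i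
    have hk' := congrFun h ⟨k, by omega⟩
    simp only [code] at hk'
    split_ifs at hk' with h1 h2 h2
    · rw [h1.choose_spec i, h2.choose_spec i, Sum.inl_injective hk']
    · rw [hconst g hg k h1 i, hconst g' hg' k h2 i]
      simpa using hk'
  funext i
  have h1 := (key _ (hg.le i) i).1 le_rfl
  have h2 := (key _ (hg'.le i) i).2 le_rfl
  omega

end IsPhase

section

open Turing Turing.PartrecToTM2 StateTransition

/-- The symbol displayed at a position of horizontal phase `p` and vertical phase `r`: the marks
`1, 3, 5` are visible in the row of vertical phase `1` only. -/
def sig (p r : ℕ) : Fin 6 := if r = 1 then if p % 2 = 1 then Fin.ofNat 6 p else 0 else 4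

/-- The same symbols, with everything outside two isolated columns replaced by `2`. -/
def maskedSig (a p r : ℕ) : Fin 6 := if a = 0 ∨ a = 2 then 2 else sig p r

/-- The marks of `h` do not code a halting computation. -/
def NoHalt (h v : ℤ → ℕ) : Prop :=
  ∀ r pa pb pc : ℤ, v r = 1 → h pa = 1 → h pb = 3 → h pc = 5 →
    ¬ Halts (pb - pa - 2).toNat (pc - pb - 2).toNat

/-- The columns isolated by `l` do not match the first two marks of `h`, or the third mark is
missing. -/
def Mismatch (l h : ℤ → ℕ) : Prop :=
  (∀ i, ¬ (l i = 1 ∧ h i = 1)) ∨ (∀ i, ¬ (l i = 3 ∧ h i = 3)) ∨ ∀ i, h i ≠ 5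

/-- The shift of marked rows not coding a halting computation. -/
def shiftY : Set (ℤ × ℤ → Fin 6) :=
  {y | ∃ h v, IsPhase 6 h ∧ IsPhase 2 v ∧ NoHalt h v ∧ y = fun t => sig (h t.1) (v t.2)}

/-- The shift of masked configurations. -/
def shiftX : Set (ℤ × ℤ → Fin 6) :=
  {x | ∃ l h v, IsPhase 4 l ∧ IsPhase 6 h ∧ IsPhase 2 v ∧ Mismatch l h ∧
    x = fun t => maskedSig (l t.1) (h t.1) (v t.2)}

theorem shiftY_shift : ∀ y ∈ shiftY, ∀ t, (fun u => y (t + u)) ∈ shiftY := by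
  rintro _ ⟨h, v, hh, hv, hn, rfl⟩ t
  refine ⟨_, _, hh.shift t.1, hv.shift t.2, fun r pa pb pc hr ha hb hc => ?_, rfl⟩
  have := hn _ _ _ _ hr ha hb hc
  rwa [show t.1 + pb - (t.1 + pa) - 2 = pb - pa - 2 by ring,
    show t.1 + pc - (t.1 + pb) - 2 = pc - pb - 2 by ring] at this

theorem shiftX_shift : ∀ x ∈ shiftX, ∀ t, (fun u => x (t + u)) ∈ shiftX := by
  rintro _ ⟨l, h, v, hl, hh, hv, hn, rfl⟩ t
  refine ⟨_, _, _, hl.shift t.1, hh.shift t.1, hv.shift t.2, ?_, rfl⟩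
  rcases hn with hn | hn | hn
  · exact .inl fun i => hn _
  · exact .inr (.inl fun i => hn _)
  · exact .inr (.inr fun i => hn _)

theorem shiftY_countable : shiftY.Countable := by
  refine (((IsPhase.countable 6).prod (IsPhase.countable 2)).image
    fun p t => sig (p.1 t.1) (p.2 t.2)).mono ?_
  rintro _ ⟨h, v, hh, hv, -, rfl⟩
  exact ⟨(h, v), ⟨hh, hv⟩, rfl⟩

theorem shiftX_countable : shiftX.Countable := by
  refine (((IsPhase.countable 4).prod ((IsPhase.countable 6).prod (IsPhase.countable 2))).image
    fun p t => maskedSig (p.1 t.1) (p.2.1 t.1) (p.2.2 t.2)).mono ?_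
  rintro _ ⟨l, h, v, hl, hh, hv, -, rfl⟩
  exact ⟨(l, h, v), ⟨hl, hh, hv⟩, rfl⟩

theorem eq_of_forall_succ_eq {α : Type*} {g : ℤ → α} (hg : ∀ j, g (j + 1) = g j) (i j : ℤ) :
    g i = g j := by
  have : ∀ j, g j = g 0 := by
    intro j
    induction j using Int.induction_on with
    | zero => rfl
    | succ n ih => rw [hg, ih]
    | pred n ih =>
      rw [← ih, ← hg (-n - 1)]
      congr 1
      ring
  rw [this i, this j]

theorem shiftX_isSofic : IsSofic shiftX := by
  let T := Fin 5 × Fin 7 × Fin 3 × Fin 3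
  let ok : T → T → T → T → Prop := fun a r _ u =>
    (PhaseStep a.1 r.1 ∧ u.1 = a.1) ∧ (PhaseStep a.2.1 r.2.1 ∧ u.2.1 = a.2.1) ∧
    (PhaseStep a.2.2.1 u.2.2.1 ∧ r.2.2.1 = a.2.2.1) ∧
    (r.2.2.2 = a.2.2.2 ∧ u.2.2.2 = a.2.2.2) ∧
    (a.2.2.2 = 0 → ¬ (a.1 = 1 ∧ a.2.1 = 1)) ∧ (a.2.2.2 = 1 → ¬ (a.1 = 3 ∧ a.2.1 = 3)) ∧
    (a.2.2.2 = 2 → a.2.1 ≠ 5)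
  convert isSofic_of_localRule ok fun a => maskedSig a.1 a.2.1 a.2.2.1 using 1
  ext x
  constructor
  · rintro ⟨l, h, v, hl, hh, hv, hm, rfl⟩
    have hl' := hl.le
    have hh' := hh.le
    have hv' := hv.le
    obtain ⟨f, hf⟩ : ∃ f : Fin 3, (f = 0 → ∀ i, ¬ (l i = 1 ∧ h i = 1)) ∧
        (f = 1 → ∀ i, ¬ (l i = 3 ∧ h i = 3)) ∧ (f = 2 → ∀ i, h i ≠ 5) := by
      rcases hm with hm | hm | hm
      · exact ⟨0, fun _ => hm, by simp, by simp⟩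
      · exact ⟨1, by simp, fun _ => hm, by simp⟩
      · exact ⟨2, by simp, by simp, fun _ => hm⟩
    refine ⟨fun t => (⟨l t.1, by have := hl' t.1; omega⟩, ⟨h t.1, by have := hh' t.1; omega⟩,
      ⟨v t.2, by have := hv' t.2; omega⟩, f), fun i j => ?_, rfl⟩
    refine ⟨⟨(hl i).2, rfl⟩, ⟨(hh i).2, rfl⟩, ⟨(hv j).2, rfl⟩, ⟨rfl, rfl⟩, fun h0 => ?_,
      fun h0 => ?_, fun h0 => ?_⟩
    · simpa [Fin.ext_iff] using hf.1 h0 i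
    · simpa [Fin.ext_iff] using hf.2.1 h0 i
    · simpa [Fin.ext_iff] using hf.2.2 h0 i
  · rintro ⟨z, hz, rfl⟩
    have el : ∀ i j, (z (i, j)).1 = (z (i, 0)).1 := fun i j =>
      eq_of_forall_succ_eq (g := fun j => (z (i, j)).1) (fun j => (hz i j).1.2) j 0
    have eh : ∀ i j, (z (i, j)).2.1 = (z (i, 0)).2.1 := fun i j =>
      eq_of_forall_succ_eq (g := fun j => (z (i, j)).2.1) (fun j => (hz i j).2.1.2) j 0
    have ev : ∀ i j, (z (i, j)).2.2.1 = (z (0, j)).2.2.1 := fun i j =>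
      eq_of_forall_succ_eq (g := fun i => (z (i, j)).2.2.1) (fun i => (hz i j).2.2.1.2) i 0
    have ef : ∀ i, (z (i, 0)).2.2.2 = (z (0, 0)).2.2.2 := fun i =>
      eq_of_forall_succ_eq (g := fun i => (z (i, 0)).2.2.2) (fun i => (hz i 0).2.2.2.1.1) i 0
    refine ⟨fun i => (z (i, 0)).1, fun i => (z (i, 0)).2.1, fun j => (z (0, j)).2.2.1,
      fun i => ⟨Nat.le_of_lt_succ (z (i, 0)).1.2, (hz i 0).1.1⟩,
      fun i => ⟨Nat.le_of_lt_succ (z (i, 0)).2.1.2, (hz i 0).2.1.1⟩,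
      fun j => ⟨Nat.le_of_lt_succ (z (0, j)).2.2.1.2, (hz 0 j).2.2.1.1⟩, ?_, ?_⟩
    · have h3 : (z (0, 0)).2.2.2 = 0 ∨ (z (0, 0)).2.2.2 = 1 ∨ (z (0, 0)).2.2.2 = 2 := by omega
      rcases h3 with h3 | h3 | h3
      · refine .inl fun i => ?_
        simpa [Fin.ext_iff] using (hz i 0).2.2.2.2.1 ((ef i).trans h3)
      · refine .inr (.inl fun i => ?_)
        simpa [Fin.ext_iff] using (hz i 0).2.2.2.2.2.1 ((ef i).trans h3)
      · refine .inr (.inr fun i => ?_)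
        simpa [Fin.ext_iff] using (hz i 0).2.2.2.2.2.2 ((ef i).trans h3)
    · funext t
      obtain ⟨i, j⟩ := t
      simp only [el i j, eh i j, ev i j]

/-- The initial stack contents in terms of the horizontal phases. -/
def phaseStacks (p : ℕ) (κ : K') : Option Γ' :=
  if κ = .main then
    if p = 1 ∨ p = 2 ∨ p = 4 then some .bit1 else if p = 3 ∨ p = 5 then some .cons else none
  else none

theorem phaseStacks_eq {h : ℤ → ℕ} (hh : IsPhase 6 h) {pa pb pc i : ℤ} (ha : h pa = 1)
    (hb : h pb = 3) (hc : h pc = 5) (hi : 1 ≤ h i) :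
    phaseStacks (h i) = fun κ =>
      inputStacks (pb - pa - 2).toNat (pc - pb - 2).toNat κ (i - pa).toNat := by
  have h6 := hh.le i
  have a1 := hh.lt_iff_of_odd (i := pa) (by omega)
  have a2 := hh.le_iff_of_odd (i := pa) (by omega)
  have b1 := hh.lt_iff_of_odd (i := pb) (by omega)
  have b2 := hh.le_iff_of_odd (i := pb) (by omega)
  have c1 := hh.lt_iff_of_odd (i := pc) (by omega)
  have c2 := hh.le_iff_of_odd (i := pc) (by omega)
  have sa := hh.succ_of_odd (i := pa) (by omega)
  have sb := hh.succ_of_odd (i := pb) (by omega)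
  have d1 := b1 (pa + 1)
  have d2 := b2 (pa + 1)
  have d3 := c1 (pb + 1)
  have d4 := c2 (pb + 1)
  have a1 := a1 i
  have a2 := a2 i
  have b1 := b1 i
  have b2 := b2 i
  have c1 := c1 i
  have c2 := c2 i
  funext κ
  unfold phaseStacks inputStacks
  split_ifs with hκ h1 h2
  · unfold inputWord
    split_ifs <;> first | rfl | (exfalso; omega)
  · unfold inputWord
    split_ifs <;> first | rfl | (exfalso; omega)
  · unfold inputWord
    split_ifs <;> first | rfl | (exfalso; omega)
  · rfl

theorem shiftY_isSofic : IsSofic shiftY := by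
  obtain ⟨Q, _, q₀, δ, hδ⟩ := exists_stackMachine
  let T := Fin 7 × Fin 3 × Fin 5 × Q × (K' → Option Γ') × (K' → Option Γ')
  let upd : ℕ → StackOp Γ' → Option Γ' → Option Γ' → Option Γ' → Option Γ' :=
    fun p op l a r => match op with
    | .stay => a
    | .pop => r
    | .push γ => if p = 1 then some γ else l
  let comp : T → T → T → T → Prop := fun a r l u =>
    match a, r, l, u with
    | (h, v, _, q, top, st), (_, _, _, rq, rtop, rst), (_, _, _, _, _, lst),
        (_, _, _, uq, _, ust) =>
      rq = q ∧ rtop = top ∧ (h = 1 → top = st) ∧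
      (v = 1 → q = q₀ ∧ (1 ≤ h.1 → st = phaseStacks h)) ∧
      (1 ≤ v.1 → 1 ≤ h.1 → ∃ ops, δ q top = some (uq, ops) ∧
        ∀ k, ust k = upd h (ops k) (lst k) (st k) (rst k))
  let ok : T → T → T → T → Prop := fun a r l u =>
    (PhaseStep a.1 r.1 ∧ u.1 = a.1) ∧ (PhaseStep a.2.1 u.2.1 ∧ r.2.1 = a.2.1) ∧
    (r.2.2.1 = a.2.2.1 ∧ u.2.2.1 = a.2.2.1) ∧
    (a.2.2.1 = 0 → a.2.1 ≠ 1) ∧ (a.2.2.1 = 1 → a.1 ≠ 1) ∧ (a.2.2.1 = 2 → a.1 ≠ 3) ∧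
    (a.2.2.1 = 3 → a.1 ≠ 5) ∧ (a.2.2.1 = 4 → comp a r l u)
  convert isSofic_of_localRule ok fun a => sig a.1 a.2.1 using 1
  ext y
  constructor
  · rintro ⟨h, v, hh, hv, hn, rfl⟩
    have hh' := hh.le
    have hv' := hv.le
    by_cases hm : ∃ r pa pb pc, v r = 1 ∧ h pa = 1 ∧ h pb = 3 ∧ h pc = 5
    · obtain ⟨r, pa, pb, pc, hr, ha, hb, hc⟩ := hm
      have hn := hn r pa pb pc hr ha hb hc
      rw [← hδ] at hn
      set c₀ : Q × (K' → ℕ → Option Γ') :=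
        (q₀, inputStacks (pb - pa - 2).toNat (pc - pb - 2).toNat)
      let run : ℕ → Q × (K' → ℕ → Option Γ') := fun t =>
        (fun c => (cfgStep δ c).getD c)^[t] c₀
      have hrun : ∀ t, Reaches (cfgStep δ) c₀ (run t) ∧
          cfgStep δ (run t) = some (run (t + 1)) := by
        have hstep : ∀ t, Reaches (cfgStep δ) c₀ (run t) →
            cfgStep δ (run t) = some (run (t + 1)) := by
          intro t ht
          have hne : cfgStep δ (run t) ≠ none := fun h0 =>
            hn (Part.dom_iff_mem.2 ⟨_, mem_eval.2 ⟨ht, h0⟩⟩)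
          obtain ⟨c, hc⟩ := Option.ne_none_iff_exists'.1 hne
          simp only [run, Function.iterate_succ_apply'] at hc ⊢
          rw [hc, Option.getD_some]
        intro t
        induction t with
        | zero => exact ⟨Relation.ReflTransGen.refl, hstep 0 Relation.ReflTransGen.refl⟩
        | succ t ih =>
          have := ih.1.tail ih.2
          exact ⟨this, hstep _ this⟩
      refine ⟨fun t => (⟨h t.1, by have := hh' t.1; omega⟩, ⟨v t.2, by have := hv' t.2; omega⟩, 4,
        (run (t.2 - r).toNat).1, fun k => (run (t.2 - r).toNat).2 k 0,
        fun k => (run (t.2 - r).toNat).2 k (t.1 - pa).toNat), fun i j => ?_, rfl⟩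
      have hi := hh.eq_iff_of_odd (i := pa) (by omega) i
      have hi' := hh.le_iff_of_odd (i := pa) (by omega) i
      have hj := hv.eq_iff_of_odd (i := r) (by omega) j
      have hj' := hv.le_iff_of_odd (i := r) (by omega) j
      rw [ha] at hi hi'
      rw [hr] at hj hj'
      refine ⟨⟨(hh i).2, rfl⟩, ⟨(hv j).2, rfl⟩, ⟨rfl, rfl⟩, by simp, by simp, by simp, by simp,
        fun _ => ⟨rfl, rfl, fun h1 => ?_, fun h1 => ?_, fun h1 h2 => ?_⟩⟩
      · have h1 : h i = 1 := by simpa [Fin.ext_iff] using h1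
        simp [hi.1 h1]
      · have h1 : v j = 1 := by simpa [Fin.ext_iff] using h1
        obtain rfl := hj.1 h1
        simp only [sub_self, Int.toNat_zero]
        exact ⟨rfl, fun h2 => (phaseStacks_eq hh ha hb hc h2).symm⟩
      · simp only at h1 h2
        have h3 : (j + 1 - r).toNat = (j - r).toNat + 1 := by omega
        have h4 := (hrun (j - r).toNat).2
        simp only [h3]
        rw [cfgStep, Option.map_eq_some_iff] at h4
        obtain ⟨⟨q', ops⟩, h5, h6⟩ := h4
        refine ⟨ops, ?_, fun k => ?_⟩
        · rw [h5, ← h6]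
        · rw [← h6]
          simp only [upd]
          cases ops k with
          | stay => rfl
          | pop =>
            show _ = (run (j - r).toNat).2 k (i + 1 - pa).toNat
            rw [show (i + 1 - pa).toNat = (i - pa).toNat + 1 by omega]
            rfl
          | push γ =>
            show _ = if h i = 1 then some γ else (run (j - r).toNat).2 k (i - 1 - pa).toNat
            by_cases h7 : h i = 1
            · rw [if_pos h7, hi.1 h7]
              simp [StackOp.apply]
            · have h8 : (i - pa).toNat = (i - 1 - pa).toNat + 1 := by omega
              rw [if_neg h7, h8]
              rfl
    · obtain ⟨f, hf⟩ : ∃ f : Fin 5, (f = 0 → ∀ j, v j ≠ 1) ∧ (f = 1 → ∀ i, h i ≠ 1) ∧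
          (f = 2 → ∀ i, h i ≠ 3) ∧ (f = 3 → ∀ i, h i ≠ 5) ∧ f ≠ 4 := by
        by_cases h0 : ∃ r, v r = 1
        · by_cases h1 : ∃ i, h i = 1
          · by_cases h2 : ∃ i, h i = 3
            · have h3 : ∀ i, h i ≠ 5 := by
                intro i hi
                obtain ⟨r, hr⟩ := h0
                obtain ⟨a, ha⟩ := h1
                obtain ⟨b, hb⟩ := h2
                exact hm ⟨r, a, b, i, hr, ha, hb, hi⟩
              exact ⟨3, by simp, by simp, by simp, fun _ => h3, by simp⟩
            · exact ⟨2, by simp, by simp, fun _ i hi => h2 ⟨i, hi⟩, by simp, by simp⟩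
          · exact ⟨1, by simp, fun _ i hi => h1 ⟨i, hi⟩, by simp, by simp, by simp⟩
        · exact ⟨0, fun _ i hi => h0 ⟨i, hi⟩, by simp, by simp, by simp, by simp⟩
      refine ⟨fun t => (⟨h t.1, by have := hh' t.1; omega⟩, ⟨v t.2, by have := hv' t.2; omega⟩, f,
        q₀, fun _ => none, fun _ => none), fun i j => ?_, rfl⟩
      refine ⟨⟨(hh i).2, rfl⟩, ⟨(hv j).2, rfl⟩, ⟨rfl, rfl⟩, fun h0 => ?_, fun h0 => ?_,
        fun h0 => ?_, fun h0 => ?_, fun h0 => absurd h0 hf.2.2.2.2⟩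
      · simpa [Fin.ext_iff] using hf.1 h0 j
      · simpa [Fin.ext_iff] using hf.2.1 h0 i
      · simpa [Fin.ext_iff] using hf.2.2.1 h0 i
      · simpa [Fin.ext_iff] using hf.2.2.2.1 h0 i
  · rintro ⟨z, hz, rfl⟩
    have eh : ∀ i j, (z (i, j)).1 = (z (i, 0)).1 := fun i j =>
      eq_of_forall_succ_eq (g := fun j => (z (i, j)).1) (fun j => (hz i j).1.2) j 0
    have ev : ∀ i j, (z (i, j)).2.1 = (z (0, j)).2.1 := fun i j =>
      eq_of_forall_succ_eq (g := fun i => (z (i, j)).2.1) (fun i => (hz i j).2.1.2) i 0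
    have ef : ∀ i j, (z (i, j)).2.2.1 = (z (0, 0)).2.2.1 := fun i j =>
      (eq_of_forall_succ_eq (g := fun i => (z (i, j)).2.2.1) (fun i => (hz i j).2.2.1.1) i 0).trans
      (eq_of_forall_succ_eq (g := fun j => (z (0, j)).2.2.1) (fun j => (hz 0 j).2.2.1.2) j 0)
    have hh : IsPhase 6 fun i => (z (i, 0)).1 := fun i =>
      ⟨Nat.le_of_lt_succ (z (i, 0)).1.2, (hz i 0).1.1⟩
    have hv : IsPhase 2 fun j => (z (0, j)).2.1 := fun j =>
      ⟨Nat.le_of_lt_succ (z (0, j)).2.1.2, (hz 0 j).2.1.1⟩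
    refine ⟨_, _, hh, hv, fun r pa pb pc hr ha hb hc hH => ?_, ?_⟩
    · have f0 := (hz pa r).2.2.2.1
      have f1 := (hz pa r).2.2.2.2.1
      have f2 := (hz pb r).2.2.2.2.2.1
      have f3 := (hz pc r).2.2.2.2.2.2.1
      rw [ef, ev, (Fin.ext hr : (z (0, r)).2.1 = 1)] at f0
      rw [ef, eh, (Fin.ext ha : (z (pa, 0)).1 = 1)] at f1
      rw [ef, eh, (Fin.ext hb : (z (pb, 0)).1 = 3)] at f2
      rw [ef, eh, (Fin.ext hc : (z (pc, 0)).1 = 5)] at f3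
      have f4 : (z (0, 0)).2.2.1 = 4 := by omega
      have hcomp := fun i j => (hz i j).2.2.2.2.2.2.2 ((ef i j).trans f4)
      simp only [comp] at hcomp
      have ha' : (z (pa, 0)).1.1 = 1 := ha
      have hr' : (z (0, r)).2.1.1 = 1 := hr
      have eq : ∀ i j, (z (i, j)).2.2.2.1 = (z (pa, j)).2.2.2.1 := fun i j =>
        eq_of_forall_succ_eq (g := fun i => (z (i, j)).2.2.2.1) (fun i => (hcomp i j).1) i pa
      have et : ∀ i j, (z (i, j)).2.2.2.2.1 = (z (pa, j)).2.2.2.2.1 := fun i j =>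
        eq_of_forall_succ_eq (g := fun i => (z (i, j)).2.2.2.2.1) (fun i => (hcomp i j).2.1) i pa
      have hi : ∀ i j, (z (i, j)).1.1 = 1 ↔ i = pa := fun i j => by
        rw [eh]
        have := hh.eq_iff_of_odd (i := pa) (by rw [ha']) i
        simp only [ha'] at this
        exact this
      have hi' : ∀ i j, 1 ≤ (z (i, j)).1.1 ↔ pa ≤ i := fun i j => by
        rw [eh]
        have := hh.le_iff_of_odd (i := pa) (by rw [ha']) i
        simp only [ha'] at this
        exact this
      have hj' : ∀ i j, 1 ≤ (z (i, j)).2.1.1 ↔ r ≤ j := fun i j => by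
        rw [ev]
        have := hv.le_iff_of_odd (i := r) (by rw [hr']) j
        simp only [hr'] at this
        exact this
      have htop : ∀ j, (z (pa, j)).2.2.2.2.1 = (z (pa, j)).2.2.2.2.2 := fun j =>
        (hcomp pa j).2.2.1 (Fin.ext ((hi pa j).2 rfl))
      let C : ℕ → Q × (K' → ℕ → Option Γ') := fun t =>
        ((z (pa, r + t)).2.2.2.1, fun κ n => (z (pa + n, r + t)).2.2.2.2.2 κ)
      have hC0 : C 0 = (q₀, inputStacks (pb - pa - 2).toNat (pc - pb - 2).toNat) := by
        have h0 : ∀ i, (z (i, r)).2.1 = 1 := fun i => by rw [ev]; exact Fin.ext hr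
        simp only [C, Nat.cast_zero, add_zero, Prod.mk.injEq]
        refine ⟨((hcomp pa r).2.2.2.1 (h0 _)).1, ?_⟩
        funext κ n
        have h1 := ((hcomp (pa + n) r).2.2.2.1 (h0 _)).2 ((hi' _ _).2 (by omega))
        have h2 := phaseStacks_eq hh ha hb hc (i := pa + n) (by
          have := (hi' (pa + n) 0).2 (by omega)
          exact this)
        rw [h1, eh]
        refine (congrFun h2 κ).trans ?_
        rw [show (pa + n - pa).toNat = n by omega]
      have hCstep : ∀ t, cfgStep δ (C t) = some (C (t + 1)) := by
        intro t
        have hjt := fun i => (hj' i (r + t)).2 (by omega)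
        have h1 := fun i hp => (hcomp i (r + t)).2.2.2.2 (hjt i) ((hi' i (r + t)).2 hp)
        obtain ⟨ops, h2, -⟩ := h1 pa le_rfl
        have h3 : ∀ i, pa ≤ i → ∀ κ, (z (i, r + t + 1)).2.2.2.2.2 κ =
            upd (z (i, r + t)).1 (ops κ) ((z (i - 1, r + t)).2.2.2.2.2 κ)
              ((z (i, r + t)).2.2.2.2.2 κ) ((z (i + 1, r + t)).2.2.2.2.2 κ) := by
          intro i hp
          obtain ⟨ops', h4, h5⟩ := h1 i hp
          rw [eq i, et i, h2] at h4
          simp only [Option.some.injEq, Prod.mk.injEq] at h4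
          rw [h4.2]
          exact h5
        rw [htop] at h2
        have h6 : δ (C t).1 (fun k => (C t).2 k 0) =
            some ((z (pa, r + t + 1)).2.2.2.1, ops) := by
          simp only [C, Nat.cast_zero, add_zero]
          exact h2
        rw [cfgStep, h6]
        simp only [Option.map_some, Option.some.injEq, C, Nat.cast_add, Nat.cast_one, ← add_assoc]
        congr 1
        funext κ n
        rw [h3 _ (by omega)]
        simp only [upd]
        cases ops κ with
        | stay => rfl
        | pop => simp [StackOp.apply, add_assoc]
        | push γ =>
          show _ = if _ then _ else _
          cases n with
          | zero => rw [if_pos ((hi _ _).2 (by simp))]; rfl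
          | succ n =>
            rw [if_neg (by rw [hi]; omega)]
            show (z (pa + n, r + t)).2.2.2.2.2 κ = _
            rw [show pa + (n + 1 : ℕ) - 1 = pa + n by push_cast; ring]
      rw [← hδ, ← hC0] at hH
      obtain ⟨b, hb⟩ := Part.dom_iff_mem.1 hH
      obtain ⟨hr1, hr2⟩ := mem_eval.1 hb
      have hreach : ∀ b, Reaches (cfgStep δ) (C 0) b → ∃ t, b = C t := by
        intro b hb
        induction hb with
        | refl => exact ⟨0, rfl⟩
        | tail _ h ih =>
          obtain ⟨t, rfl⟩ := ih
          rw [hCstep] at h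
          exact ⟨t + 1, (Option.some_injective _ h).symm⟩
      obtain ⟨t, rfl⟩ := hreach b hr1
      rw [hCstep] at hr2
      cases hr2
    · funext t
      obtain ⟨i, j⟩ := t
      simp only [eh i j, ev i j]

end

theorem sig_ne_two {p : ℕ} (hp : p ≤ 6) (r : ℕ) : sig p r ≠ 2 := by
  by_cases hr : r = 1
  · interval_cases p <;> simp [sig, hr, Fin.ext_iff]
  · simp [sig, hr, Fin.ext_iff]

theorem sig_eq_four {p : ℕ} (hp : p ≤ 6) (r : ℕ) : sig p r = 4 ↔ r ≠ 1 := by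
  by_cases hr : r = 1
  · interval_cases p <;> simp [sig, hr, Fin.ext_iff]
  · simp [sig, hr]

theorem sig_eq_odd {p q r : ℕ} (hp : p ≤ 6) (hq : q ≤ 6) (h2 : q % 2 = 1)
    (h : sig p r = sig q 1) : r = 1 ∧ p = q := by
  have hr : r = 1 := by
    by_contra hr
    rw [(sig_eq_four hp r).2 hr] at h
    exact (sig_eq_four hq 1).1 h.symm rfl
  subst hr
  refine ⟨rfl, ?_⟩
  revert h
  interval_cases q <;> first | omega | (interval_cases p <;> simp [sig, Fin.ext_iff])

theorem maskedSig_eq_two {a p r : ℕ} (hp : p ≤ 6) : maskedSig a p r = 2 ↔ a = 0 ∨ a = 2 := by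
  unfold maskedSig
  split_ifs with h
  · simp [h]
  · simp [h, sig_ne_two hp r]

theorem maskedSig_of_ne_two {a p r : ℕ} (h : maskedSig a p r ≠ 2) :
    maskedSig a p r = sig p r := by
  unfold maskedSig at *
  split_ifs at * with h'
  · exact absurd rfl h
  · rfl

/-- A pattern isolating two columns at distance `k + 2` in a row. -/
def gapCode (k : ℕ) : List ((ℤ × ℤ) × Option (Fin 6)) :=
  ((0, 0), some 2) :: ((1, 0), none) :: ((((k + 3 : ℕ) : ℤ), 0), none) ::
    (List.range (k + 1)).map fun i => ((((i + 2 : ℕ) : ℤ), 0), some 2)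

/-- The phases isolating the columns `1` and `k + 3`. -/
def gapPhase (k : ℕ) (i : ℤ) : ℕ :=
  if i ≤ 0 then 0 else if i = 1 then 1 else if i < k + 3 then 2 else if i = k + 3 then 3 else 4

theorem gapPhase_isPhase (k : ℕ) : IsPhase 4 (gapPhase k) := by
  intro i
  unfold gapPhase PhaseStep
  split_ifs <;> omega

/-- The phases with marks at positions `1`, `k + 3` and `k + m + 5`. -/
def markPhase (k m : ℕ) (i : ℤ) : ℕ :=
  if i ≤ 0 then 0 else if i = 1 then 1 else if i < k + 3 then 2 else if i = k + 3 then 3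
  else if i < k + m + 5 then 4 else if i = k + m + 5 then 5 else 6

theorem markPhase_isPhase (k m : ℕ) : IsPhase 6 (markPhase k m) := by
  intro i
  unfold markPhase PhaseStep
  split_ifs <;> omega

/-- The phases with a mark at position `0`. -/
def rowPhase (i : ℤ) : ℕ := if i < 0 then 0 else if i = 0 then 1 else 2

theorem rowPhase_isPhase : IsPhase 2 rowPhase := by
  intro i
  unfold rowPhase PhaseStep
  split_ifs <;> omega

theorem gapCode_mem_of_forall {k : ℕ} (hk : ∀ m, Halts k m) :
    Encodable.encode (gapCode k) ∈ patCodes 6 (lang (univExt shiftX shiftY)) := by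
  rw [encode_mem_patCodes]
  refine ⟨fun t => if gapPhase k t.1 = 0 ∨ gapPhase k t.1 = 2 then some 2 else none, ?_, ?_⟩
  · rw [mem_univExt_iff shiftX_shift shiftY_shift]
    rintro n _ ⟨h, v, hh, hv, hn, rfl⟩
    by_cases hr : ∃ r, v r = 1
    · obtain ⟨r, hr⟩ := hr
      refine ⟨_, ⟨gapPhase k, h, v, gapPhase_isPhase k, hh, hv, ?_, rfl⟩, fun p _ => ?_⟩
      · by_contra hc
        unfold Mismatch at hc
        push Not at hc
        obtain ⟨⟨a, ha, ha'⟩, ⟨b, hb, hb'⟩, c, hc⟩ := hc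
        have h1 : a = 1 := by unfold gapPhase at ha; split_ifs at ha <;> omega
        have h2 : b = k + 3 := by unfold gapPhase at hb; split_ifs at hb <;> omega
        have := hn r a b c hr ha' hb' hc
        rw [show (b - a - 2).toNat = k by omega] at this
        exact this (hk _)
      · beta_reduce
        unfold maskedSig
        split_ifs <;> rfl
    · refine ⟨_, ⟨gapPhase k, fun _ => 0, v, gapPhase_isPhase k, IsPhase.const (by omega) rfl, hv,
        .inr (.inr fun i => by simp), rfl⟩, fun p _ => ?_⟩
      have hp : v p.2 ≠ 1 := fun h => hr ⟨_, h⟩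
      beta_reduce
      unfold maskedSig
      split_ifs
      · rfl
      · simp [sig, hp]
  · intro p hp
    simp only [gapCode, List.mem_cons, List.mem_map, List.mem_range] at hp
    rcases hp with rfl | rfl | rfl | ⟨i, hi, rfl⟩
    · simp [gapPhase]
    · simp [gapPhase]
    · beta_reduce
      rw [if_neg]
      unfold gapPhase
      dsimp only
      split_ifs <;> first | omega | simp
    · beta_reduce
      rw [if_pos]
      unfold gapPhase
      dsimp only
      split_ifs <;> omega

theorem forall_halts_of_gapCode_mem {k : ℕ}
    (hmem : Encodable.encode (gapCode k) ∈ patCodes 6 (lang (univExt shiftX shiftY))) (m : ℕ) :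
    Halts k m := by
  rw [encode_mem_patCodes] at hmem
  obtain ⟨x, hx, hc⟩ := hmem
  rw [mem_univExt_iff shiftX_shift shiftY_shift] at hx
  have x0 : x (0, 0) = some 2 := hc ((0, 0), some 2) (by simp [gapCode])
  have x1 : x (1, 0) = none := hc ((1, 0), none) (by simp [gapCode])
  have x3 : x (((k + 3 : ℕ) : ℤ), 0) = none := hc ((((k + 3 : ℕ) : ℤ), 0), none)
    (by simp only [gapCode, List.mem_cons, true_or, or_true])
  have x2 : ∀ i ≤ k, x (((i + 2 : ℕ) : ℤ), 0) = some 2 := fun i hi =>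
    hc ((((i + 2 : ℕ) : ℤ), 0), some 2) (by
      simp only [gapCode, List.mem_cons, List.mem_map, List.mem_range]
      exact .inr (.inr (.inr ⟨i, by omega, rfl⟩)))
  have hbox : ∀ i : ℕ, i ≤ k + m + 10 → ((i : ℤ), (0 : ℤ)) ∈ box (k + m + 10) := by
    intro i hi
    rw [mem_box]
    simp only
    omega
  have main : ∀ h v, IsPhase 6 h → IsPhase 2 v → NoHalt h v → ∃ h' v', IsPhase 6 h' ∧
      IsPhase 2 v' ∧ (∃ l, IsPhase 4 l ∧ l 1 = 1 ∧ l (k + 3) = 3 ∧ Mismatch l h') ∧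
      sig (h' 1) (v' 0) = sig (h 1) (v 0) ∧
      ∀ i : ℕ, k + 3 ≤ i → i ≤ k + m + 10 →
        sig (h' i) (v' 0) = (x ((i : ℤ), 0)).getD (sig (h i) (v 0)) := by
    intro h v hh hv hn
    obtain ⟨_, ⟨l, h', v', hl, hh', hv', hm, rfl⟩, hag⟩ := hx (k + m + 10) _
      ⟨h, v, hh, hv, hn, rfl⟩
    have hag' : ∀ i : ℕ, i ≤ k + m + 10 → maskedSig (l i) (h' i) (v' 0) =
        (x ((i : ℤ), 0)).getD (sig (h i) (v 0)) := fun i hi => hag _ (hbox i hi)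
    have l0 : l 0 = 0 ∨ l 0 = 2 := by
      have := hag' 0 (by omega)
      rw [Nat.cast_zero, x0] at this
      exact (maskedSig_eq_two (hh'.le _)).1 this
    have l2 : ∀ i ≤ k, l ((i + 2 : ℕ) : ℤ) = 0 ∨ l ((i + 2 : ℕ) : ℤ) = 2 := by
      intro i hi
      have := hag' (i + 2) (by omega)
      rw [x2 i hi] at this
      exact (maskedSig_eq_two (hh'.le _)).1 this
    have m1 := hag' 1 (by omega)
    rw [Nat.cast_one, x1, Option.getD_none] at m1
    have m1' : maskedSig (l 1) (h' 1) (v' 0) ≠ 2 := by rw [m1]; exact sig_ne_two (hh.le _) _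
    have l1 := mt (maskedSig_eq_two (hh'.le _)).2 m1'
    have m3 := hag' (k + 3) (by omega)
    rw [x3, Option.getD_none] at m3
    have m3' : maskedSig (l ((k + 3 : ℕ) : ℤ)) (h' ((k + 3 : ℕ) : ℤ)) (v' 0) ≠ 2 := by
      rw [m3]; exact sig_ne_two (hh.le _) _
    have l3 := mt (maskedSig_eq_two (hh'.le _)).2 m3'
    have s0 := (hl 0).2
    have s1 := (hl 1).2
    have s2 := (hl ((k + 2 : ℕ) : ℤ)).2
    have t0 := l2 0 (by omega)
    have t1 := l2 k le_rfl
    have mono2 := hl.mono (show (2 : ℤ) ≤ ((k + 2 : ℕ) : ℤ) by omega)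
    rw [show ((k + 2 : ℕ) : ℤ) + 1 = ((k + 3 : ℕ) : ℤ) by push_cast; ring] at s2
    norm_num at s0 s1 t0
    unfold PhaseStep at s0 s1 s2
    have r1 : l 1 = 1 := by omega
    have r3 : l ((k + 3 : ℕ) : ℤ) = 3 := by omega
    refine ⟨h', v', hh', hv', ⟨l, hl, r1, by exact_mod_cast r3, hm⟩, ?_, fun i hi hi' => ?_⟩
    · rw [← m1, maskedSig_of_ne_two m1']
    · rw [← hag' i hi', maskedSig_of_ne_two]
      rw [Ne, maskedSig_eq_two (hh'.le _)]
      have := (hl.le_iff_of_odd (i := ((k + 3 : ℕ) : ℤ)) (by omega) i).2 (by omega)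
      omega
  by_contra hm
  have z6 : IsPhase 6 fun _ => 0 := IsPhase.const (by omega) rfl
  have z2 : IsPhase 2 fun _ => 0 := IsPhase.const (by omega) rfl
  have hnone : ∀ i : ℕ, k + 3 ≤ i → i ≤ k + m + 10 → x ((i : ℤ), 0) = none := by
    intro i hi hi'
    by_contra hne
    obtain ⟨s, hs⟩ := Option.ne_none_iff_exists'.1 hne
    obtain ⟨h₁, v₁, hh₁, -, -, a1, a2⟩ := main _ _ z6 z2 fun r _ _ _ hr => by simp at hr
    obtain ⟨h₂, v₂, hh₂, -, -, b1, b2⟩ := main _ _ z6 rowPhase_isPhase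
      fun _ pa _ _ _ ha => by simp at ha
    have a3 := a2 i hi hi'
    have b3 := b2 i hi hi'
    rw [hs, Option.getD_some] at a3 b3
    have a4 : v₁ 0 ≠ 1 := by
      rw [← sig_eq_four (hh₁.le 1), a1]; rfl
    have b4 : ¬ v₂ 0 ≠ 1 := by
      rw [← sig_eq_four (hh₂.le 1), b1]; simp [rowPhase, sig, Fin.ext_iff]
    rw [← sig_eq_four (hh₁.le i), a3] at a4
    rw [← sig_eq_four (hh₂.le i), b3] at b4
    exact b4 a4
  obtain ⟨h, v, hh, hv, ⟨l, -, l1, l3, hmis⟩, c1, c2⟩ := main (markPhase k m) rowPhase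
    (markPhase_isPhase k m) rowPhase_isPhase (by
      intro r pa pb pc _ ha hb hc
      have h1 : pa = 1 := by unfold markPhase at ha; split_ifs at ha <;> omega
      have h2 : pb = k + 3 := by unfold markPhase at hb; split_ifs at hb <;> omega
      have h3 : pc = k + m + 5 := by unfold markPhase at hc; split_ifs at hc <;> omega
      rwa [show (pb - pa - 2).toNat = k by omega, show (pc - pb - 2).toNat = m by omega])
  have d3 := c2 (k + 3) le_rfl (by omega)
  have d5 := c2 (k + m + 5) (by omega) (by omega)
  rw [hnone _ (by omega) (by omega), Option.getD_none] at d3 d5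
  have e1 : markPhase k m 1 = 1 := by unfold markPhase; split_ifs <;> omega
  have e3 : markPhase k m ((k + 3 : ℕ) : ℤ) = 3 := by unfold markPhase; split_ifs <;> omega
  have e5 : markPhase k m ((k + m + 5 : ℕ) : ℤ) = 5 := by unfold markPhase; split_ifs <;> omega
  have er : rowPhase 0 = 1 := by simp [rowPhase]
  rw [e1, er] at c1
  rw [e3, er] at d3
  rw [e5, er] at d5
  have f1 := (sig_eq_odd (hh.le _) (by omega) rfl c1).2
  have f3 := (sig_eq_odd (hh.le _) (by omega) rfl d3).2
  have f5 := (sig_eq_odd (hh.le _) (by omega) rfl d5).2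
  rcases hmis with hmis | hmis | hmis
  · exact hmis 1 ⟨l1, f1⟩
  · exact hmis (k + 3) ⟨l3, by exact_mod_cast f3⟩
  · exact hmis _ f5

theorem gapCode_mem_iff (k : ℕ) :
    Encodable.encode (gapCode k) ∈ patCodes 6 (lang (univExt shiftX shiftY)) ↔ ∀ m, Halts k m :=
  ⟨forall_halts_of_gapCode_mem, gapCode_mem_of_forall⟩

theorem primrec_natCast_sub : Primrec₂ fun i n : ℕ => (i : ℤ) - n := by
  refine Primrec.encode_iff.1 (Primrec.of_eq (f := fun p : ℕ × ℕ =>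
    if p.2 ≤ p.1 then 2 * (p.1 - p.2) else 2 * (p.2 - p.1 - 1) + 1) ?_ fun p => ?_)
  · refine Primrec.ite (Primrec.nat_le.comp Primrec.snd Primrec.fst) ?_ (Primrec.succ.comp ?_)
    · exact Primrec.nat_mul.comp (Primrec.const 2) (Primrec.nat_sub.comp Primrec.fst Primrec.snd)
    · exact Primrec.nat_mul.comp (Primrec.const 2) (Primrec.nat_sub.comp
        (Primrec.nat_sub.comp Primrec.snd Primrec.fst) (Primrec.const 1))
  · have h1 : ∀ n : ℕ, Encodable.encode (n : ℤ) = 2 * n := fun _ => rfl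
    have h2 : ∀ n : ℕ, Encodable.encode (Int.negSucc n) = 2 * n + 1 := fun _ => rfl
    split_ifs with h
    · rw [← h1, Nat.cast_sub h]
    · rw [← h2]
      congr 1
      dsimp only
      omega

theorem primrec_natCast : Primrec fun n : ℕ => (n : ℤ) :=
  (primrec_natCast_sub.comp Primrec.id (Primrec.const 0)).of_eq fun n => by simp

theorem primrec_gapCode : Primrec gapCode := by
  have hg : Primrec₂ fun _ i : ℕ => ((((i + 2 : ℕ) : ℤ), (0 : ℤ)), (some 2 : Option (Fin 6))) :=
    (Primrec.pair (Primrec.pair (primrec_natCast.comp (Primrec.nat_add.comp Primrec.snd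
      (Primrec.const 2))) (Primrec.const _)) (Primrec.const _))
  refine Primrec.list_cons.comp (Primrec.const _) (Primrec.list_cons.comp (Primrec.const _)
    (Primrec.list_cons.comp (Primrec.pair (Primrec.pair ?_ (Primrec.const _)) (Primrec.const _))
      (Primrec.list_map (Primrec.list_range.comp Primrec.succ) hg)))
  exact primrec_natCast.comp (Primrec.nat_add.comp Primrec.id (Primrec.const 3))

/-- Every `Π⁰₂` set reduces to the language of the universal extension. -/
theorem exists_reduction {M : Set ℕ} (hM : PiTwoNat M) :
    ∃ f : ℕ → ℕ, Computable f ∧ M = f ⁻¹' patCodes 6 (lang (univExt shiftX shiftY)) := by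
  obtain ⟨R, hR, hMR⟩ := hM
  have hp : Partrec fun p : ℕ × ℕ => Nat.rfind fun n => Part.some (R p.1 p.2 n) := by
    refine Partrec.rfind (p := fun (p : ℕ × ℕ) n => (R p.1 p.2 n : Part Bool)) ?_
    exact (hR.comp ((Computable.fst.comp Computable.fst).pair
      ((Computable.snd.comp Computable.fst).pair Computable.snd))).partrec
  have hp' := hp.comp (Primrec.unpair.to_comp)
  obtain ⟨c, hc⟩ := Nat.Partrec.Code.exists_code.1 (Partrec.nat_iff.1 hp')
  refine ⟨fun k => Encodable.encode (gapCode (Nat.pair (Encodable.encode c) k)), ?_, ?_⟩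
  · exact (Primrec.encode.comp (primrec_gapCode.comp
      (Primrec₂.natPair.comp (Primrec.const _) Primrec.id))).to_comp
  · ext k
    rw [hMR, Set.mem_preimage, gapCode_mem_iff]
    refine forall_congr' fun m => ?_
    simp only [Halts, Nat.unpair_pair, Denumerable.ofNat_encode, hc]
    refine Iff.trans ?_ Nat.rfind_dom.symm
    simp only [Part.mem_some_iff, Part.some_dom, implies_true, and_true]
    exact exists_congr fun n => eq_comm

/-- The `i`-th digit of `a` in base seven. -/
def dig (a i : ℕ) : ℕ := a / 7 ^ i % 7

theorem dig_lt (a i : ℕ) : dig a i < 7 := Nat.mod_lt _ (by omega)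

theorem exists_dig (w : ℕ → ℕ) (N : ℕ) (hw : ∀ i < N, w i < 7) :
    ∃ a < 7 ^ N, ∀ i < N, dig a i = w i := by
  induction N generalizing w with
  | zero => exact ⟨0, by simp, by simp⟩
  | succ N ih =>
    obtain ⟨a, ha, h⟩ := ih (fun i => w (i + 1)) fun i hi => hw _ (by omega)
    have h0 := hw 0 (by omega)
    refine ⟨7 * a + w 0, by rw [pow_succ]; omega, fun i hi => ?_⟩
    cases i with
    | zero => simp only [dig, pow_zero, Nat.div_one]; omega
    | succ i =>
      rw [← h i (by omega), dig, dig, pow_succ', ← Nat.div_div_eq_div_mul]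
      congr 2
      omega

/-- The first `N` digits of `a` are at most `m` and obey the phase rules. -/
def IsWord (m N a : ℕ) : Prop :=
  ∀ i < N, dig a i ≤ m ∧ (i + 1 < N → PhaseStep (dig a i) (dig a (i + 1)))

theorem IsPhase.exists_word {m : ℕ} (hm : m ≤ 6) {g : ℤ → ℕ} (hg : IsPhase m g) (N : ℕ) (n : ℤ) :
    ∃ a < 7 ^ N, IsWord m N a ∧ ∀ i < N, g (i - n) = dig a i := by
  obtain ⟨a, ha, h⟩ := exists_dig (fun i => g (i - n)) N
    fun i _ => (hg.le _).trans_lt (by omega)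
  refine ⟨a, ha, fun i hi => ⟨?_, fun hi' => ?_⟩, fun i hi => (h i hi).symm⟩
  · rw [h i hi]
    exact hg.le _
  · rw [h i hi, h _ hi', show ((i + 1 : ℕ) : ℤ) - n = i - n + 1 by push_cast; ring]
    exact (hg _).2

theorem IsWord.exists_phase {m N a : ℕ} (ha : IsWord m N a) (hm : m % 2 = 0) (hN : 0 < N)
    (n : ℤ) : ∃ g, IsPhase m g ∧ (∀ i < N, g (i - n) = dig a i) ∧
      ∀ z, g z % 2 = 1 → ∃ i < N, z = i - n :=
  IsPhase.exists_extend hm hN _ (fun i hi => (ha i hi).1)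
    (fun i hi => (ha i (by omega)).2 hi) n

/-- The marks of the words `h` and `v` code a computation halting with fuel `t`. -/
def HaltWin (N t h v : ℕ) : Prop :=
  ∃ r < N, ∃ a < N, ∃ b < N, ∃ c < N, (dig v r = 1 ∧ dig h a = 1 ∧ dig h b = 3 ∧ dig h c = 5) ∧
    (Nat.Partrec.Code.evaln t
      (Denumerable.ofNat Nat.Partrec.Code (b - a - 2).unpair.1)
      (Nat.pair (b - a - 2).unpair.2 (c - b - 2))).isSome

/-- The finite version of `Mismatch`. -/
def MismatchWin (N l h : ℕ) : Prop :=
  (∀ i < N, ¬ (dig l i = 1 ∧ dig h i = 1)) ∨ (∀ i < N, ¬ (dig l i = 3 ∧ dig h i = 3)) ∨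
    ∀ i < N, dig h i ≠ 5

/-- The window `e`, filled by the signals of `(h, v)`, shows the masked signals of
`(l, h', v')`. -/
def MatchWin (N e h v l h' v' : ℕ) : Prop :=
  ∀ i < N, ∀ j < N, (maskedSig (dig l i) (dig h' i) (dig v' j)).val =
    if dig e (i * N + j) = 0 then (sig (dig h i) (dig v j)).val else dig e (i * N + j) - 1

/-- The window `e`, filled by the signals of `(h, v)`, can be explained by a configuration of
`shiftX`. -/
def MaskWin (N e h v : ℕ) : Prop :=
  ∃ l < 7 ^ N, ∃ h' < 7 ^ N, ∃ v' < 7 ^ N, (IsWord 4 N l ∧ IsWord 6 N h' ∧ IsWord 2 N v') ∧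
    MismatchWin N l h' ∧ MatchWin N e h v l h' v'

/-- Every filling of the window `e` can be explained, up to those discarded with fuel `t`. -/
def FillsWin (N e t : ℕ) : Prop :=
  ∀ h < 7 ^ N, ∀ v < 7 ^ N, IsWord 6 N h ∧ IsWord 2 N v → HaltWin N t h v ∨ MaskWin N e h v

/-- The digit coding a symbol or a hole. -/
def symCode (o : Option (Fin 6)) : ℕ := o.elim 0 fun s => s.val + 1

theorem symCode_injective : Function.Injective symCode := by
  decide

theorem symCode_le (o : Option (Fin 6)) : symCode o < 7 := by
  revert o
  decide

theorem eq_getD_iff (s u : Fin 6) (o : Option (Fin 6)) :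
    s = o.getD u ↔ s.val = if symCode o = 0 then u.val else symCode o - 1 := by
  rw [Fin.ext_iff]
  cases o <;> simp [symCode]

/-- The window `e` agrees with the code `c` of a pattern in the box of radius `n`. -/
def AgreeWin (c : List ((ℤ × ℤ) × Option (Fin 6))) (n e : ℕ) : Prop :=
  ∀ p ∈ c, ∀ i < 2 * n + 1, ∀ j < 2 * n + 1, p.1 = ((i : ℤ) - n, (j : ℤ) - n) →
    symCode p.2 = dig e (i * (2 * n + 1) + j)

theorem mem_box_iff_exists {n : ℕ} {p : ℤ × ℤ} :
    p ∈ box n ↔ ∃ i < 2 * n + 1, ∃ j < 2 * n + 1, p = ((i : ℤ) - n, (j : ℤ) - n) := by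
  rw [mem_box]
  constructor
  · rintro ⟨⟨h1, h2⟩, h3, h4⟩
    refine ⟨(p.1 + n).toNat, by omega, (p.2 + n).toNat, by omega, Prod.ext ?_ ?_⟩ <;>
      dsimp only <;> omega
  · rintro ⟨i, hi, j, hj, rfl⟩
    dsimp only
    omega

theorem HaltWin.mono {N t t' h v : ℕ} (ht : t ≤ t') (hw : HaltWin N t h v) :
    HaltWin N t' h v := by
  obtain ⟨r, hr, a, ha, b, hb, c, hc, h1, h2⟩ := hw
  refine ⟨r, hr, a, ha, b, hb, c, hc, h1, ?_⟩
  obtain ⟨x, hx⟩ := Option.isSome_iff_exists.1 h2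
  exact Option.isSome_iff_exists.2 ⟨x, Nat.Partrec.Code.evaln_mono ht hx⟩

theorem halts_iff_exists_evaln {K m : ℕ} : Halts K m ↔ ∃ t, (Nat.Partrec.Code.evaln t
    (Denumerable.ofNat Nat.Partrec.Code K.unpair.1) (Nat.pair K.unpair.2 m)).isSome := by
  simp only [Option.isSome_iff_exists]
  rw [exists_comm, Halts, Part.dom_iff_mem]
  exact exists_congr fun x => Nat.Partrec.Code.evaln_complete

theorem not_haltWin_of_noHalt {h v : ℤ → ℕ} (hn : NoHalt h v) {N t a b : ℕ} {n : ℤ}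
    (ha : ∀ i < N, h (i - n) = dig a i) (hb : ∀ i < N, v (i - n) = dig b i) :
    ¬ HaltWin N t a b := by
  rintro ⟨r, hr, pa, hpa, pb, hpb, pc, hpc, ⟨h1, h2, h3, h4⟩, h5⟩
  rw [← hb _ hr] at h1
  rw [← ha _ hpa] at h2
  rw [← ha _ hpb] at h3
  rw [← ha _ hpc] at h4
  refine hn _ _ _ _ h1 h2 h3 h4 (halts_iff_exists_evaln.2 ⟨t, ?_⟩)
  rwa [show ((pb : ℤ) - n - (pa - n) - 2).toNat = pb - pa - 2 by omega,
    show ((pc : ℤ) - n - (pb - n) - 2).toNat = pc - pb - 2 by omega]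

theorem exists_haltWin {h v : ℤ → ℕ} (hn : ¬ NoHalt h v) {N a b : ℕ} {n : ℤ}
    (ha : ∀ i < N, h (i - n) = dig a i) (hb : ∀ i < N, v (i - n) = dig b i)
    (ha' : ∀ z, h z % 2 = 1 → ∃ i < N, z = i - n) (hb' : ∀ z, v z % 2 = 1 → ∃ i < N, z = i - n) :
    ∃ t, HaltWin N t a b := by
  unfold NoHalt at hn
  push Not at hn
  obtain ⟨r, pa, pb, pc, h1, h2, h3, h4, h5⟩ := hn
  obtain ⟨r, hr, rfl⟩ := hb' r (by omega)
  obtain ⟨pa, hpa, rfl⟩ := ha' pa (by omega)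
  obtain ⟨pb, hpb, rfl⟩ := ha' pb (by omega)
  obtain ⟨pc, hpc, rfl⟩ := ha' pc (by omega)
  obtain ⟨t, ht⟩ := halts_iff_exists_evaln.1 h5
  rw [hb _ hr] at h1
  rw [ha _ hpa] at h2
  rw [ha _ hpb] at h3
  rw [ha _ hpc] at h4
  refine ⟨t, r, hr, pa, hpa, pb, hpb, pc, hpc, ⟨h1, h2, h3, h4⟩, ?_⟩
  rwa [show ((pb : ℤ) - n - (pa - n) - 2).toNat = pb - pa - 2 by omega,
    show ((pc : ℤ) - n - (pb - n) - 2).toNat = pc - pb - 2 by omega] at ht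

theorem mismatchWin_iff {l h : ℤ → ℕ} {N a b : ℕ} {n : ℤ}
    (ha : ∀ i < N, l (i - n) = dig a i) (hb : ∀ i < N, h (i - n) = dig b i)
    (hb' : ∀ z, h z % 2 = 1 → ∃ i < N, z = i - n) : MismatchWin N a b ↔ Mismatch l h := by
  have key : ∀ q : ℕ → ℕ → Prop, ∀ s, s % 2 = 1 → ((∀ i < N, ¬ (q (dig a i) s ∧ dig b i = s)) ↔
      ∀ z, ¬ (q (l z) s ∧ h z = s)) := by
    intro q s hs
    constructor
    · rintro H z ⟨h1, h2⟩
      obtain ⟨i, hi, rfl⟩ := hb' z (by omega)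
      exact H i hi ⟨ha i hi ▸ h1, hb i hi ▸ h2⟩
    · rintro H i hi ⟨h1, h2⟩
      exact H (i - n) ⟨(ha i hi).symm ▸ h1, (hb i hi).symm ▸ h2⟩
  have k1 := key (· = ·) 1 rfl
  have k2 := key (· = ·) 3 rfl
  have k3 := key (fun _ _ => True) 5 rfl
  simp only [true_and] at k3
  exact or_congr k1 (or_congr k2 k3)

theorem mismatchWin_of_mismatch {l h : ℤ → ℕ} (hm : Mismatch l h) {N a b : ℕ} {n : ℤ}
    (ha : ∀ i < N, l (i - n) = dig a i) (hb : ∀ i < N, h (i - n) = dig b i) :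
    MismatchWin N a b := by
  rcases hm with hm | hm | hm
  · exact .inl fun i hi => by rw [← ha i hi, ← hb i hi]; exact hm _
  · exact .inr (.inl fun i hi => by rw [← ha i hi, ← hb i hi]; exact hm _)
  · exact .inr (.inr fun i hi => by rw [← hb i hi]; exact hm _)

theorem matchWin_iff {h v l h' v' : ℤ → ℕ} {n e a b a' b' c' : ℕ} {x : ℤ × ℤ → Option (Fin 6)}
    (hx : ∀ i < 2 * n + 1, ∀ j < 2 * n + 1,
      symCode (x ((i : ℤ) - n, (j : ℤ) - n)) = dig e (i * (2 * n + 1) + j))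
    (hh : ∀ i < 2 * n + 1, h (i - n) = dig a i) (hv : ∀ i < 2 * n + 1, v (i - n) = dig b i)
    (hl : ∀ i < 2 * n + 1, l (i - n) = dig a' i) (hh' : ∀ i < 2 * n + 1, h' (i - n) = dig b' i)
    (hv' : ∀ i < 2 * n + 1, v' (i - n) = dig c' i) :
    MatchWin (2 * n + 1) e a b a' b' c' ↔ ∀ p ∈ box n,
      maskedSig (l p.1) (h' p.1) (v' p.2) = (x p).getD (sig (h p.1) (v p.2)) := by
  constructor
  · intro H p hp
    obtain ⟨i, hi, j, hj, rfl⟩ := mem_box_iff_exists.1 hp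
    rw [eq_getD_iff, hx i hi j hj, hh i hi, hl i hi, hh' i hi, hv j hj, hv' j hj]
    exact H i hi j hj
  · intro H i hi j hj
    have := H _ (mem_box_iff_exists.2 ⟨i, hi, j, hj, rfl⟩)
    rwa [eq_getD_iff, hx i hi j hj, hh i hi, hl i hi, hh' i hi, hv j hj, hv' j hj] at this

theorem fillsTo_iff_exists_fillsWin {n e : ℕ} {x : ℤ × ℤ → Option (Fin 6)}
    (hx : ∀ i < 2 * n + 1, ∀ j < 2 * n + 1,
      symCode (x ((i : ℤ) - n, (j : ℤ) - n)) = dig e (i * (2 * n + 1) + j)) :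
    FillsTo shiftX shiftY n x ↔ ∃ t, FillsWin (2 * n + 1) e t := by
  constructor
  · intro H
    have key : ∀ h v : ℕ, ∃ t₀, ∀ t ≥ t₀, IsWord 6 (2 * n + 1) h ∧ IsWord 2 (2 * n + 1) v →
        HaltWin (2 * n + 1) t h v ∨ MaskWin (2 * n + 1) e h v := by
      intro a b
      by_cases hab : IsWord 6 (2 * n + 1) a ∧ IsWord 2 (2 * n + 1) b
      swap
      · exact ⟨0, fun _ _ h => absurd h hab⟩
      obtain ⟨h, hh, ha, ha'⟩ := hab.1.exists_phase rfl (by omega) n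
      obtain ⟨v, hv, hb, hb'⟩ := hab.2.exists_phase rfl (by omega) n
      by_cases hn : NoHalt h v
      · obtain ⟨_, ⟨l, h', v', hl, hh', hv', hm, rfl⟩, hag⟩ := H _ ⟨h, v, hh, hv, hn, rfl⟩
        obtain ⟨a₁, ha₁, hw₁, hd₁⟩ := hl.exists_word (by omega) (2 * n + 1) n
        obtain ⟨a₂, ha₂, hw₂, hd₂⟩ := hh'.exists_word (by omega) (2 * n + 1) n
        obtain ⟨a₃, ha₃, hw₃, hd₃⟩ := hv'.exists_word (by omega) (2 * n + 1) n
        exact ⟨0, fun _ _ _ => .inr ⟨a₁, ha₁, a₂, ha₂, a₃, ha₃, ⟨hw₁, hw₂, hw₃⟩,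
          mismatchWin_of_mismatch hm hd₁ hd₂, (matchWin_iff hx ha hb hd₁ hd₂ hd₃).2 hag⟩⟩
      · obtain ⟨t, ht⟩ := exists_haltWin hn ha hb ha' hb'
        exact ⟨t, fun _ h _ => .inl (ht.mono h)⟩
    choose t₀ ht₀ using key
    refine ⟨(Finset.range (7 ^ (2 * n + 1)) ×ˢ Finset.range (7 ^ (2 * n + 1))).sup
      fun p => t₀ p.1 p.2, fun h hh v hv => ht₀ h v _ ?_⟩
    exact Finset.le_sup (f := fun p : ℕ × ℕ => t₀ p.1 p.2) (b := (h, v)) (by simp [hh, hv])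
  · rintro ⟨t, H⟩ _ ⟨h, v, hh, hv, hn, rfl⟩
    obtain ⟨a, ha, hwa, hda⟩ := hh.exists_word (by omega) (2 * n + 1) n
    obtain ⟨b, hb, hwb, hdb⟩ := hv.exists_word (by omega) (2 * n + 1) n
    obtain hw | ⟨a₁, -, a₂, -, a₃, -, ⟨hw₁, hw₂, hw₃⟩, hm, hag⟩ := H a ha b hb ⟨hwa, hwb⟩
    · exact absurd hw (not_haltWin_of_noHalt hn hda hdb)
    · obtain ⟨l, hl, hd₁, -⟩ := hw₁.exists_phase rfl (by omega) n
      obtain ⟨h', hh', hd₂, ho⟩ := hw₂.exists_phase rfl (by omega) n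
      obtain ⟨v', hv', hd₃, -⟩ := hw₃.exists_phase rfl (by omega) n
      exact ⟨_, ⟨l, h', v', hl, hh', hv', (mismatchWin_iff hd₁ hd₂ ho).1 hm, rfl⟩,
        (matchWin_iff hx hda hdb hd₁ hd₂ hd₃).1 hag⟩

theorem agreeWin_iff {c : List ((ℤ × ℤ) × Option (Fin 6))} {n e : ℕ}
    {x : ℤ × ℤ → Option (Fin 6)} (hx : ∀ i < 2 * n + 1, ∀ j < 2 * n + 1,
      symCode (x ((i : ℤ) - n, (j : ℤ) - n)) = dig e (i * (2 * n + 1) + j)) :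
    AgreeWin c n e ↔ ∀ p ∈ c, p.1 ∈ box n → x p.1 = p.2 := by
  constructor
  · intro H p hp hb
    obtain ⟨i, hi, j, hj, h⟩ := mem_box_iff_exists.1 hb
    apply symCode_injective
    rw [H p hp i hi j hj h, h, hx i hi j hj]
  · intro H p hp i hi j hj h
    rw [← hx i hi j hj, ← h, H p hp (mem_box_iff_exists.2 ⟨i, hi, j, hj, h⟩)]

theorem exists_window (c : List ((ℤ × ℤ) × Option (Fin 6))) (n : ℕ) :
    (∃ x, (∀ p ∈ c, p.1 ∈ box n → x p.1 = p.2) ∧ FillsTo shiftX shiftY n x) ↔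
      ∃ e t, AgreeWin c n e ∧ FillsWin (2 * n + 1) e t := by
  constructor
  · rintro ⟨x, h1, h2⟩
    obtain ⟨e, -, he⟩ := exists_dig (fun k => symCode
      (x (((k / (2 * n + 1) : ℕ) : ℤ) - n, ((k % (2 * n + 1) : ℕ) : ℤ) - n)))
      ((2 * n + 1) * (2 * n + 1)) fun _ _ => symCode_le _
    have hx : ∀ i < 2 * n + 1, ∀ j < 2 * n + 1,
        symCode (x ((i : ℤ) - n, (j : ℤ) - n)) = dig e (i * (2 * n + 1) + j) := by
      intro i hi j hj
      rw [he _ (by nlinarith), Nat.mul_comm, Nat.mul_add_div (by omega), Nat.div_eq_of_lt hj,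
        Nat.mul_add_mod, Nat.mod_eq_of_lt hj, add_zero]
    obtain ⟨t, ht⟩ := (fillsTo_iff_exists_fillsWin hx).1 h2
    exact ⟨e, t, (agreeWin_iff hx).2 h1, ht⟩
  · rintro ⟨e, t, h1, h2⟩
    have hsym : ∀ d < 7, ∃ o, symCode o = d := by decide
    choose! s hs using hsym
    let x : ℤ × ℤ → Option (Fin 6) := fun p =>
      s (dig e ((p.1 + n).toNat * (2 * n + 1) + (p.2 + n).toNat))
    have hx : ∀ i < 2 * n + 1, ∀ j < 2 * n + 1,
        symCode (x ((i : ℤ) - n, (j : ℤ) - n)) = dig e (i * (2 * n + 1) + j) := by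
      intro i hi j hj
      simp only [x, sub_add_cancel, Int.toNat_natCast]
      exact hs _ (dig_lt _ _)
    exact ⟨x, (agreeWin_iff hx).1 h1, (fillsTo_iff_exists_fillsWin hx).2 ⟨t, h2⟩⟩

theorem primrecPred_ball {α : Type*} [Primcodable α] {b : α → ℕ} {p : α → ℕ → Prop}
    (hb : Primrec b) (hp : PrimrecPred fun q : α × ℕ => p q.1 q.2) :
    PrimrecPred fun a => ∀ x < b a, p a x :=
  ((PrimrecRel.forall_mem_list (R := fun x a => p a x)
    (hp.comp (Primrec.pair Primrec.snd Primrec.fst))).comp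
      (Primrec.list_range.comp hb) Primrec.id).of_eq (by simp)

theorem primrecPred_bex {α : Type*} [Primcodable α] {b : α → ℕ} {p : α → ℕ → Prop}
    (hb : Primrec b) (hp : PrimrecPred fun q : α × ℕ => p q.1 q.2) :
    PrimrecPred fun a => ∃ x < b a, p a x :=
  ((PrimrecRel.exists_mem_list (R := fun x a => p a x)
    (hp.comp (Primrec.pair Primrec.snd Primrec.fst))).comp
      (Primrec.list_range.comp hb) Primrec.id).of_eq (by simp)

theorem primrecPred_imp {α : Type*} [Primcodable α] {p q : α → Prop} (hp : PrimrecPred p)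
    (hq : PrimrecPred q) : PrimrecPred fun a => p a → q a :=
  (hp.not.or hq).of_eq fun _ => imp_iff_not_or.symm

theorem primrec_seven_pow : Primrec fun n : ℕ => 7 ^ n := by
  have : Primrec fun n : ℕ => (Nat.rec 1 (fun _ b => b * 7) n : ℕ) :=
    Primrec.nat_rec₁ 1 (Primrec.nat_mul.comp Primrec.snd (Primrec.const 7))
  refine this.of_eq fun n => ?_
  induction n with
  | zero => rfl
  | succ n ih => simp only [ih]; rw [pow_succ]

theorem primrec_dig : Primrec₂ dig :=
  Primrec.nat_mod.comp (Primrec.nat_div.comp Primrec.fst (primrec_seven_pow.comp Primrec.snd))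
    (Primrec.const 7)

theorem primrecRel_phaseStep : PrimrecRel PhaseStep :=
  (Primrec.eq.comp Primrec.snd (Primrec.succ.comp Primrec.fst)).or
    ((Primrec.eq.comp Primrec.snd Primrec.fst).and (Primrec.eq.comp
      (Primrec.nat_mod.comp Primrec.fst (Primrec.const 2)) (Primrec.const 0)))

theorem primrec_sig : Primrec₂ fun p r => (sig p r).val := by
  have h : Primrec fun q : ℕ × ℕ => if q.2 = 1 then if q.1 % 2 = 1 then q.1 % 6 else 0 else 4 :=
    Primrec.ite (Primrec.eq.comp Primrec.snd (Primrec.const 1))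
      (Primrec.ite (Primrec.eq.comp (Primrec.nat_mod.comp Primrec.fst (Primrec.const 2))
        (Primrec.const 1)) (Primrec.nat_mod.comp Primrec.fst (Primrec.const 6)) (Primrec.const 0))
      (Primrec.const 4)
  refine h.of_eq fun q => ?_
  dsimp only
  unfold sig
  split_ifs <;> rfl

section

variable {α : Type*} [Primcodable α]

theorem primrec_maskedSig {a p r : α → ℕ} (ha : Primrec a) (hp : Primrec p) (hr : Primrec r) :
    Primrec fun q => (maskedSig (a q) (p q) (r q)).val := by
  have h : Primrec fun q => if a q = 0 ∨ a q = 2 then 2 else (sig (p q) (r q)).val :=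
    Primrec.ite ((Primrec.eq.comp ha (Primrec.const 0)).or (Primrec.eq.comp ha (Primrec.const 2)))
      (Primrec.const 2) (primrec_sig.comp hp hr)
  refine h.of_eq fun q => ?_
  unfold maskedSig
  split_ifs <;> rfl

theorem primrecPred_isWord (m : ℕ) {N a : α → ℕ} (hN : Primrec N) (ha : Primrec a) :
    PrimrecPred fun q => IsWord m (N q) (a q) := by
  unfold IsWord
  have hs : Primrec fun q : α × ℕ => q.2 + 1 := Primrec.succ.comp Primrec.snd
  have ha' := ha.comp (Primrec.fst (β := ℕ))
  have hd := primrec_dig.comp ha' Primrec.snd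
  exact primrecPred_ball hN ((Primrec.nat_le.comp hd (Primrec.const m)).and
    (primrecPred_imp (Primrec.nat_lt.comp hs (hN.comp Primrec.fst))
      (primrecRel_phaseStep.comp hd (primrec_dig.comp ha' hs))))

theorem primrecPred_haltWin {N t h v : α → ℕ} (hN : Primrec N) (ht : Primrec t) (hh : Primrec h)
    (hv : Primrec v) : PrimrecPred fun q => HaltWin (N q) (t q) (h q) (v q) := by
  unfold HaltWin
  have p1 : Primrec fun q : (((α × ℕ) × ℕ) × ℕ) × ℕ => q.1.1.1.1 :=
    Primrec.fst.comp (Primrec.fst.comp (Primrec.fst.comp Primrec.fst))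
  have pr : Primrec fun q : (((α × ℕ) × ℕ) × ℕ) × ℕ => q.1.1.1.2 :=
    Primrec.snd.comp (Primrec.fst.comp (Primrec.fst.comp Primrec.fst))
  have pa : Primrec fun q : (((α × ℕ) × ℕ) × ℕ) × ℕ => q.1.1.2 :=
    Primrec.snd.comp (Primrec.fst.comp Primrec.fst)
  have pb : Primrec fun q : (((α × ℕ) × ℕ) × ℕ) × ℕ => q.1.2 := Primrec.snd.comp Primrec.fst
  have pc : Primrec fun q : (((α × ℕ) × ℕ) × ℕ) × ℕ => q.2 := Primrec.snd
  have hK := Primrec.unpair.comp (Primrec.nat_sub.comp (Primrec.nat_sub.comp pb pa)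
    (Primrec.const 2))
  have hm := Primrec.nat_sub.comp (Primrec.nat_sub.comp pc pb) (Primrec.const 2)
  have he := Nat.Partrec.Code.primrec_evaln.comp (Primrec.pair (Primrec.pair (ht.comp p1)
    ((Primrec.ofNat Nat.Partrec.Code).comp (Primrec.fst.comp hK)))
    (Primrec₂.natPair.comp (Primrec.snd.comp hK) hm))
  refine primrecPred_bex hN (primrecPred_bex (hN.comp Primrec.fst) (primrecPred_bex
    (hN.comp (Primrec.fst.comp Primrec.fst)) (primrecPred_bex
      (hN.comp (Primrec.fst.comp (Primrec.fst.comp Primrec.fst))) (PrimrecPred.and ?_ ?_))))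
  · exact (Primrec.eq.comp (primrec_dig.comp (hv.comp p1) pr) (Primrec.const 1)).and
      ((Primrec.eq.comp (primrec_dig.comp (hh.comp p1) pa) (Primrec.const 1)).and
      ((Primrec.eq.comp (primrec_dig.comp (hh.comp p1) pb) (Primrec.const 3)).and
      (Primrec.eq.comp (primrec_dig.comp (hh.comp p1) pc) (Primrec.const 5))))
  · exact Primrec.eq.comp (Primrec.option_isSome.comp he) (Primrec.const true)

theorem primrecPred_mismatchWin {N l h : α → ℕ} (hN : Primrec N) (hl : Primrec l)
    (hh : Primrec h) : PrimrecPred fun q => MismatchWin (N q) (l q) (h q) := by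
  unfold MismatchWin
  have dl := primrec_dig.comp (hl.comp (Primrec.fst (β := ℕ))) Primrec.snd
  have dh := primrec_dig.comp (hh.comp (Primrec.fst (β := ℕ))) Primrec.snd
  exact (primrecPred_ball hN ((Primrec.eq.comp dl (Primrec.const 1)).and
      (Primrec.eq.comp dh (Primrec.const 1))).not).or
    ((primrecPred_ball hN ((Primrec.eq.comp dl (Primrec.const 3)).and
      (Primrec.eq.comp dh (Primrec.const 3))).not).or
    (primrecPred_ball hN (Primrec.eq.comp dh (Primrec.const 5)).not))

theorem primrecPred_matchWin {N e h v l h' v' : α → ℕ} (hN : Primrec N) (he : Primrec e)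
    (hh : Primrec h) (hv : Primrec v) (hl : Primrec l) (hh' : Primrec h') (hv' : Primrec v') :
    PrimrecPred fun q => MatchWin (N q) (e q) (h q) (v q) (l q) (h' q) (v' q) := by
  unfold MatchWin
  have p1 : Primrec fun q : (α × ℕ) × ℕ => q.1.1 := Primrec.fst.comp Primrec.fst
  have pi : Primrec fun q : (α × ℕ) × ℕ => q.1.2 := Primrec.snd.comp Primrec.fst
  have pj : Primrec fun q : (α × ℕ) × ℕ => q.2 := Primrec.snd
  have hd := primrec_dig.comp (he.comp p1) (Primrec.nat_add.comp
    (Primrec.nat_mul.comp pi (hN.comp p1)) pj)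
  refine primrecPred_ball hN (primrecPred_ball (hN.comp Primrec.fst) (Primrec.eq.comp ?_ ?_))
  · exact primrec_maskedSig (primrec_dig.comp (hl.comp p1) pi) (primrec_dig.comp (hh'.comp p1) pi)
      (primrec_dig.comp (hv'.comp p1) pj)
  · exact Primrec.ite (Primrec.eq.comp hd (Primrec.const 0))
      (primrec_sig.comp (primrec_dig.comp (hh.comp p1) pi) (primrec_dig.comp (hv.comp p1) pj))
      (Primrec.nat_sub.comp hd (Primrec.const 1))

theorem primrecPred_maskWin {N e h v : α → ℕ} (hN : Primrec N) (he : Primrec e) (hh : Primrec h)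
    (hv : Primrec v) : PrimrecPred fun q => MaskWin (N q) (e q) (h q) (v q) := by
  unfold MaskWin
  have p1 : Primrec fun q : ((α × ℕ) × ℕ) × ℕ => q.1.1.1 :=
    Primrec.fst.comp (Primrec.fst.comp Primrec.fst)
  have pl : Primrec fun q : ((α × ℕ) × ℕ) × ℕ => q.1.1.2 :=
    Primrec.snd.comp (Primrec.fst.comp Primrec.fst)
  have ph : Primrec fun q : ((α × ℕ) × ℕ) × ℕ => q.1.2 := Primrec.snd.comp Primrec.fst
  have pv : Primrec fun q : ((α × ℕ) × ℕ) × ℕ => q.2 := Primrec.snd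
  have hN' := hN.comp p1
  have hb := primrec_seven_pow.comp hN
  refine primrecPred_bex hb (primrecPred_bex (hb.comp Primrec.fst) (primrecPred_bex
    (hb.comp (Primrec.fst.comp Primrec.fst)) (PrimrecPred.and ?_ (PrimrecPred.and ?_ ?_))))
  · exact (primrecPred_isWord 4 hN' pl).and
      ((primrecPred_isWord 6 hN' ph).and (primrecPred_isWord 2 hN' pv))
  · exact primrecPred_mismatchWin hN' pl ph
  · exact primrecPred_matchWin hN' (he.comp p1) (hh.comp p1) (hv.comp p1) pl ph pv

theorem primrecPred_fillsWin {N e t : α → ℕ} (hN : Primrec N) (he : Primrec e) (ht : Primrec t) :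
    PrimrecPred fun q => FillsWin (N q) (e q) (t q) := by
  unfold FillsWin
  have p1 : Primrec fun q : (α × ℕ) × ℕ => q.1.1 := Primrec.fst.comp Primrec.fst
  have ph : Primrec fun q : (α × ℕ) × ℕ => q.1.2 := Primrec.snd.comp Primrec.fst
  have pv : Primrec fun q : (α × ℕ) × ℕ => q.2 := Primrec.snd
  have hN' := hN.comp p1
  have hb := primrec_seven_pow.comp hN
  exact primrecPred_ball hb (primrecPred_ball (hb.comp Primrec.fst) (primrecPred_imp
    ((primrecPred_isWord 6 hN' ph).and (primrecPred_isWord 2 hN' pv))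
    ((primrecPred_haltWin hN' (ht.comp p1) ph pv).or (primrecPred_maskWin hN' (he.comp p1) ph pv))))

theorem primrecPred_agreeWin {c : α → List ((ℤ × ℤ) × Option (Fin 6))} {n e : α → ℕ}
    (hc : Primrec c) (hn : Primrec n) (he : Primrec e) :
    PrimrecPred fun q => AgreeWin (c q) (n q) (e q) := by
  unfold AgreeWin
  let β := ((ℤ × ℤ) × Option (Fin 6)) × α
  have hN : Primrec fun q : α => 2 * n q + 1 :=
    Primrec.succ.comp (Primrec.nat_mul.comp (Primrec.const 2) hn)
  have p0 : Primrec fun q : (β × ℕ) × ℕ => q.1.1.1 :=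
    Primrec.fst.comp (Primrec.fst.comp Primrec.fst)
  have p1 : Primrec fun q : (β × ℕ) × ℕ => q.1.1.2 :=
    Primrec.snd.comp (Primrec.fst.comp Primrec.fst)
  have pi : Primrec fun q : (β × ℕ) × ℕ => q.1.2 := Primrec.snd.comp Primrec.fst
  have pj : Primrec fun q : (β × ℕ) × ℕ => q.2 := Primrec.snd
  have hs : Primrec symCode := Primrec.dom_finite _
  have key : PrimrecRel fun (p : (ℤ × ℤ) × Option (Fin 6)) (q : α) => ∀ i < 2 * n q + 1,
      ∀ j < 2 * n q + 1, p.1 = ((i : ℤ) - n q, (j : ℤ) - n q) →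
        symCode p.2 = dig (e q) (i * (2 * n q + 1) + j) := by
    refine primrecPred_ball (hN.comp Primrec.snd) (primrecPred_ball
      (hN.comp (Primrec.snd.comp Primrec.fst)) (primrecPred_imp ?_ ?_))
    · exact Primrec.eq.comp (Primrec.fst.comp p0) (Primrec.pair
        (primrec_natCast_sub.comp pi (hn.comp p1)) (primrec_natCast_sub.comp pj (hn.comp p1)))
    · exact Primrec.eq.comp (hs.comp (Primrec.snd.comp p0)) (primrec_dig.comp (he.comp p1)
        (Primrec.nat_add.comp (Primrec.nat_mul.comp pi (hN.comp p1)) pj))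
  exact key.forall_mem_list.comp hc Primrec.id

end

/-- The language of the universal extension is `Π⁰₂`. -/
theorem piTwoNat_univExt : PiTwoNat (patCodes 6 (lang (univExt shiftX shiftY))) := by
  classical
  let C := List ((ℤ × ℤ) × Option (Fin 6))
  let p : (ℕ × ℕ × ℕ) × C → Prop := fun q => Encodable.encode q.2 = q.1.1 ∧
    AgreeWin q.2 q.1.2.1 q.1.2.2.unpair.1 ∧
    FillsWin (2 * q.1.2.1 + 1) q.1.2.2.unpair.1 q.1.2.2.unpair.2
  have hp : PrimrecPred p := by
    have hk : Primrec fun q : (ℕ × ℕ × ℕ) × C => q.1.1 := Primrec.fst.comp Primrec.fst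
    have hn : Primrec fun q : (ℕ × ℕ × ℕ) × C => q.1.2.1 :=
      Primrec.fst.comp (Primrec.snd.comp Primrec.fst)
    have hw : Primrec fun q : (ℕ × ℕ × ℕ) × C => q.1.2.2.unpair :=
      Primrec.unpair.comp (Primrec.snd.comp (Primrec.snd.comp Primrec.fst))
    exact (Primrec.eq.comp (Primrec.encode.comp Primrec.snd) hk).and
      ((primrecPred_agreeWin Primrec.snd hn (Primrec.fst.comp hw)).and
      (primrecPred_fillsWin (Primrec.succ.comp (Primrec.nat_mul.comp (Primrec.const 2) hn))
        (Primrec.fst.comp hw) (Primrec.snd.comp hw)))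
  refine ⟨fun k n w => (Encodable.decode (α := C) k).elim false fun c => decide (p ((k, n, w), c)),
    ?_, fun k => ?_⟩
  · refine (Primrec.of_eq (Primrec.option_casesOn (Primrec.decode.comp Primrec.fst)
      (Primrec.const false) hp.decide.to₂) fun q => ?_).to_comp
    dsimp only
    generalize (Encodable.decode q.1 : Option C) = o
    cases o <;> rfl
  · by_cases hk : ∃ c : C, Encodable.encode c = k
    · obtain ⟨c, rfl⟩ := hk
      rw [encode_mem_patCodes_iff shiftX_shift shiftY_shift]
      refine forall_congr' fun n => (exists_window c n).trans ?_
      simp only [Encodable.encodek, Option.elim_some, decide_eq_true_eq, p, true_and]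
      constructor
      · rintro ⟨e, t, h⟩
        exact ⟨Nat.pair e t, by simpa using h⟩
      · rintro ⟨w, h⟩
        exact ⟨_, _, h⟩
    · constructor
      · rintro ⟨c, hc, -⟩
        exact absurd ⟨c, hc⟩ hk
      · intro H
        obtain ⟨w, hw⟩ := H 0
        dsimp only at hw
        cases hd : (Encodable.decode k : Option C) with
        | none => simp [hd] at hw
        | some c =>
          rw [hd, Option.elim_some, decide_eq_true_eq] at hw
          exact absurd ⟨c, hw.1⟩ hk

/-- There are a finite alphabet `S` (wlog `S = Fin s`) and countable
two-dimensional sofic shifts `X, Y ⊆ S^{ℤ²}` such that the language of the universal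
extension `A(X,Y)` is `Π⁰₂`-complete: its code set is `Π⁰₂`, and every `Π⁰₂` subset of `ℕ`
is the preimage of its code set under some computable function. -/
theorem stmt7 :
    ∃ (s : ℕ) (X Y : Set ((ℤ × ℤ) → Fin s)),
      IsSofic X ∧ X.Countable ∧ IsSofic Y ∧ Y.Countable ∧
      PiTwoNat (patCodes s (lang (univExt X Y))) ∧
      ∀ M : Set ℕ, PiTwoNat M →
        ∃ f : ℕ → ℕ, Computable f ∧ M = f ⁻¹' patCodes s (lang (univExt X Y)) := by
  exact ⟨6, shiftX, shiftY, shiftX_isSofic, shiftX_countable, shiftY_isSofic, shiftY_countable,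
    piTwoNat_univExt, fun _ hM => exists_reduction hM⟩

end QE
end
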